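/- Existence of a sparse solution (representer theorem): assume the fidelity 𝓕 is convex and the forward operator K is a linear map from 𝒜 to the finite-dimensional data space Y = ℝᵐ which can be linearly extended to L²_w(I;ℳ(Ω)). Then there exists a solution μ^opt ∈ 𝒜 of the BV curve tracking problem such that μ^opt_t = Σ_{i=1}^N λⁱ δ_{xⁱ_t} for a.e. t ∈ [0,1], where N ≤ m, λⁱ ∈ ℝ₊, and each t ↦ xⁱ_t lies in BV([0,1]; Ω). -/

import Mathlib

open MeasureTheory Filter Topology Set
open scoped ENNReal NNReal RealInnerProductSpace

noncomputable section

/-- The unit time interval `[0,1] ⊆ ℝ`. -/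
def unitI : Set ℝ := Set.Icc 0 1

/-- Lebesgue measure restricted to the unit interval. -/
def lebI : Measure ℝ := volume.restrict unitI

/-- The (pointwise) variation of a curve `f : ℝ → X` on a set `s ⊆ ℝ`,
with respect to a distance function `d`. -/
def varOn {X : Type*} (d : X → X → ℝ≥0∞) (f : ℝ → X) (s : Set ℝ) : ℝ≥0∞ :=
  ⨆ p : ℕ × { u : ℕ → ℝ // Monotone u ∧ ∀ i, u i ∈ s },
    ∑ i ∈ Finset.range p.1, d (f (p.2.1 (i + 1))) (f (p.2.1 i))

/-- The essential variation of `f` on `s`: infimum of variations over a.e. representatives. -/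
def essVarOn {X : Type*} (d : X → X → ℝ≥0∞) (f : ℝ → X) (s : Set ℝ) : ℝ≥0∞ :=
  ⨅ g ∈ {g : ℝ → X | ∀ᵐ t ∂(volume.restrict s), g t = f t}, varOn d g s

/-- Essential variation on the unit interval. -/
def essVar {X : Type*} (d : X → X → ℝ≥0∞) (f : ℝ → X) : ℝ≥0∞ := essVarOn d f unitI

/-- Couplings (transport plans) between two measures. -/
def IsCoupling {X : Type*} [MeasurableSpace X] (ρp ρm : Measure X)
    (π : Measure (X × X)) : Prop :=
  π.map Prod.fst = ρp ∧ π.map Prod.snd = ρm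

/-- The Wasserstein-1 distance between measures. -/
def W1 {X : Type*} [MeasurableSpace X] [PseudoEMetricSpace X]
    (ρp ρm : Measure X) : ℝ≥0∞ :=
  ⨅ π ∈ {π : Measure (X × X) | IsCoupling ρp ρm π}, ∫⁻ q, edist q.1 q.2 ∂π

/-- `W1` as a distance function on measures. -/
def W1M {X : Type*} [MeasurableSpace X] [PseudoEMetricSpace X] :
    Measure X → Measure X → ℝ≥0∞ := fun a b => W1 a b

/-- Wasserstein-1 distance on probability measures. -/
def W1P {X : Type*} [MeasurableSpace X] [PseudoEMetricSpace X] :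
    ProbabilityMeasure X → ProbabilityMeasure X → ℝ≥0∞ :=
  fun a b => W1 (a : Measure X) (b : Measure X)

/-- The admissible set `𝒜 = ℝ₊ ⬝ BV(I; 𝒲₁(Ω))` of weighted BV curves of probability measures. -/
def Adm {n : ℕ} (Ω : Set (EuclideanSpace ℝ (Fin n))) : Set (ℝ → Measure ↥Ω) :=
  {μ | ∃ (c : ℝ≥0) (ρ : ℝ → ProbabilityMeasure ↥Ω),
      essVar W1P ρ < ⊤ ∧ ∀ t, μ t = (c : ℝ≥0∞) • (ρ t : Measure ↥Ω)}

/-- The weight `ω(μ)` of an admissible curve. -/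
def wt {n : ℕ} {Ω : Set (EuclideanSpace ℝ (Fin n))} (μ : ℝ → Measure ↥Ω) : ℝ :=
  (μ 0 Set.univ).toReal

/-- The regularizer `𝓡_{α,β}(μ) = α ω(μ) + β essvar(μ)`. -/
def Reg {n : ℕ} {Ω : Set (EuclideanSpace ℝ (Fin n))} (α β : ℝ)
    (μ : ℝ → Measure ↥Ω) : ℝ :=
  α * wt μ + β * (essVar W1M μ).toReal

/-- Weak-* convergence of a sequence of measures (tested against continuous functions). -/
def WStarTendsto {X : Type*} [MeasurableSpace X] [TopologicalSpace X]
    (μs : ℕ → Measure X) (μ : Measure X) : Prop :=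
  ∀ φ : C(X, ℝ), Tendsto (fun j => ∫ x, φ x ∂(μs j)) atTop (𝓝 (∫ x, φ x ∂μ))

/-- A.e. (in time) weak-* convergence of curves of measures. -/
def AEWStar {n : ℕ} {Ω : Set (EuclideanSpace ℝ (Fin n))}
    (μs : ℕ → (ℝ → Measure ↥Ω)) (μ : ℝ → Measure ↥Ω) : Prop :=
  ∀ᵐ t ∂lebI, WStarTendsto (fun j => μs j t) (μ t)

/-- Weak convergence in a real inner product space. -/
def WeakTendsto {Y : Type*} [NormedAddCommGroup Y] [InnerProductSpace ℝ Y]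
    (ys : ℕ → Y) (y : Y) : Prop :=
  ∀ z : Y, Tendsto (fun j => @inner ℝ Y _ (ys j) z) atTop (𝓝 (@inner ℝ Y _ y z))


/-- The canonical embedding of a curve of measures into the vector space of (time-indexed)
functionals on `C(Ω)`, `μ ↦ (t ↦ (φ ↦ ∫ φ dμ_t))`; through it, a linear extension of the
forward operator to (a superspace of) `L²_w(I;ℳ(Ω))` can be expressed. -/
def toFunc {n : ℕ} {Ω : Set (EuclideanSpace ℝ (Fin n))} (μ : ℝ → Measure ↥Ω) :
    ℝ → C(↥Ω, ℝ) → ℝ :=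
  fun t φ => ∫ x, φ x ∂(μ t)

/-- Gluing of finitely many discrete couplings: nonnegative matrices `w 0, …, w (k - 1)` with
matching marginals are the consecutive pair marginals of a finite weighted family of paths. -/
lemma exists_paths_of_couplings {A : Type} [Fintype A] [Nonempty A] (k : ℕ) (w : ℕ → A → A → ℝ)
    (q : ℕ → A → ℝ) (hq : ∀ i a, 0 ≤ q i a) (hw : ∀ i a b, 0 ≤ w i a b)
    (hfst : ∀ i < k, ∀ a, ∑ b, w i a b = q i a)
    (hsnd : ∀ i < k, ∀ b, ∑ a, w i a b = q (i + 1) b) :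
    ∃ (ι : Type) (_ : Fintype ι) (_ : Nonempty ι) (L : ι → ℝ) (p : ι → ℕ → A),
      (∀ j, 0 ≤ L j) ∧
      (∀ i ≤ k, ∀ f : A → ℝ, ∑ j, L j * f (p j i) = ∑ a, q i a * f a) ∧
      ∀ i < k, ∀ f : A → A → ℝ,
        ∑ j, L j * f (p j i) (p j (i + 1)) = ∑ a, ∑ b, w i a b * f a b := by
  classical
  induction k with
  | zero =>
    refine ⟨A, inferInstance, inferInstance, q 0, fun a _ => a, hq 0, ?_, by simp⟩
    intro i hi f
    obtain rfl : i = 0 := by omega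
    rfl
  | succ k ih =>
    obtain ⟨ι, _, _, L, p, hL, hone, hpair⟩ :=
      ih (fun i hi => hfst i (by omega)) (fun i hi => hsnd i (by omega))
    have hzero : ∀ j, q k (p j k) = 0 → L j = 0 := by
      intro j hj
      have h := hone k le_rfl (fun a => if a = p j k then 1 else 0)
      simp only [mul_ite, mul_one, mul_zero, Finset.sum_ite_eq', Finset.mem_univ, if_true,
        hj] at h
      have h0 := (Finset.sum_eq_zero_iff_of_nonneg (fun i _ => by
        split_ifs
        · exact hL i
        · exact le_rfl)).1 h j (Finset.mem_univ j)
      simpa using h0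
    have hwzero : ∀ a b, q k a = 0 → w k a b = 0 := by
      intro a b hab
      have h := hfst k (by omega) a
      rw [hab] at h
      exact (Finset.sum_eq_zero_iff_of_nonneg (fun b _ => hw k a b)).1 h b (Finset.mem_univ b)
    have hstep : ∀ f : A → A → ℝ,
        ∑ j, ∑ b, L j * w k (p j k) b / q k (p j k) * f (p j k) b
          = ∑ a, ∑ b, w k a b * f a b := by
      intro f
      have h := hone k le_rfl (fun a => ∑ b, w k a b / q k a * f a b)
      calc _ = ∑ j, L j * ∑ b, w k (p j k) b / q k (p j k) * f (p j k) b := by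
            refine Finset.sum_congr rfl fun j _ => ?_
            rw [Finset.mul_sum]
            exact Finset.sum_congr rfl fun b _ => by ring
        _ = _ := h
        _ = _ := by
            refine Finset.sum_congr rfl fun a _ => ?_
            rw [Finset.mul_sum]
            refine Finset.sum_congr rfl fun b _ => ?_
            by_cases h0 : q k a = 0
            · simp [h0, hwzero a b h0]
            · field_simp
    have hold : ∀ (g : ι → ℝ), ∑ j, ∑ b, L j * w k (p j k) b / q k (p j k) * g j
        = ∑ j, L j * g j := by
      intro g
      refine Finset.sum_congr rfl fun j _ => ?_
      rw [← Finset.sum_mul, ← Finset.sum_div, ← Finset.mul_sum, hfst k (by omega)]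
      by_cases h0 : q k (p j k) = 0
      · simp [hzero j h0]
      · field_simp
    refine ⟨ι × A, inferInstance, inferInstance,
      fun x => L x.1 * w k (p x.1 k) x.2 / q k (p x.1 k),
      fun x i => if i ≤ k then p x.1 i else x.2, ?_, ?_, ?_⟩
    · intro x
      exact div_nonneg (mul_nonneg (hL _) (hw _ _ _)) (hq _ _)
    · intro i hi f
      rw [Fintype.sum_prod_type]
      rcases Nat.lt_or_ge k i with h | h
      · obtain rfl : i = k + 1 := by omega
        simp only [h.not_ge, if_false]
        rw [hstep (fun _ b => f b), Finset.sum_comm]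
        refine Finset.sum_congr rfl fun b _ => ?_
        rw [← Finset.sum_mul, hsnd k (by omega)]
      · simp only [h, if_true]
        rw [hold (fun j => f (p j i)), hone i h]
    · intro i hi f
      rw [Fintype.sum_prod_type]
      rcases Nat.lt_or_ge i k with h | h
      · simp only [h.le, if_true, Nat.succ_le_of_lt h]
        rw [hold (fun j => f (p j i) (p j (i + 1))), hpair i h]
      · obtain rfl : i = k := by omega
        simpa using hstep f

/-- Conic Carathéodory with a cost: a conic combination can be replaced by one with at most
`finrank` active vectors, the same value, and no larger cost, if all costs are positive. -/
lemma exists_conic_combination_card_le_finrank {ι E : Type*} [Fintype ι] [AddCommGroup E]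
    [Module ℝ E] [FiniteDimensional ℝ E] (a : ι → E) (c : ι → ℝ) (hc : ∀ i, 0 < c i)
    (L : ι → ℝ) (hL : ∀ i, 0 ≤ L i) :
    ∃ L' : ι → ℝ, (∀ i, 0 ≤ L' i) ∧ {i | L' i ≠ 0}.ncard ≤ Module.finrank ℝ E ∧
      ∑ i, L' i • a i = ∑ i, L i • a i ∧ ∑ i, L' i * c i ≤ ∑ i, L i * c i := by
  classical
  induction hn : {i | L i ≠ 0}.ncard using Nat.strong_induction_on generalizing L with
  | _ N ih =>
  subst hn
  by_cases hcard : {i | L i ≠ 0}.ncard ≤ Module.finrank ℝ E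
  · exact ⟨L, hL, hcard, rfl, le_rfl⟩
  have hdep : ¬ LinearIndependent ℝ (fun i : {i | L i ≠ 0} => a i) := by
    intro h
    apply hcard
    have := h.fintype_card_le_finrank
    rwa [← Nat.card_eq_fintype_card] at this
  obtain ⟨g, hg, i₁, hi₁⟩ := Fintype.not_linearIndependent_iff.1 hdep
  obtain ⟨d, hd0, hdsum, hdne, hdc⟩ : ∃ d : ι → ℝ, (∀ i, L i = 0 → d i = 0) ∧
      ∑ i, d i • a i = 0 ∧ (∃ i, d i ≠ 0) ∧ ∑ i, d i * c i ≤ 0 := by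
    let d : ι → ℝ := fun i => if h : L i ≠ 0 then g ⟨i, h⟩ else 0
    have h0 : ∀ i, L i = 0 → d i = 0 := fun i hi => by simp [d, hi]
    have hs : ∑ i, d i • a i = 0 := by
      rw [← hg]
      have h1 : ∀ i : {i | L i ≠ 0}, g i • a i = d i • a i := by
        rintro ⟨i, hi⟩
        have hi' : L i ≠ 0 := hi
        simp [d, hi']
      rw [Finset.sum_congr rfl (fun i _ => h1 i),
        ← Finset.sum_subtype (Finset.univ.filter fun i => L i ≠ 0) (by simp)
          (fun i => d i • a i)]
      symm
      apply Finset.sum_subset (Finset.subset_univ _)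
      intro i _ hi
      rw [h0 i (by simpa using hi), zero_smul]
    have hne : d i₁ ≠ 0 := by
      have hi' : L i₁ ≠ 0 := i₁.2
      simpa [d, hi'] using hi₁
    rcases le_total (∑ i, d i * c i) 0 with h | h
    · exact ⟨d, h0, hs, ⟨_, hne⟩, h⟩
    · refine ⟨fun i => - d i, fun i hi => by simp [h0 i hi], ?_, ⟨_, neg_ne_zero.2 hne⟩, ?_⟩
      · simp [hs]
      · simpa using h
  have hneg : (Finset.univ.filter fun i => d i < 0).Nonempty := by
    by_contra hcon
    rw [Finset.not_nonempty_iff_eq_empty, Finset.filter_eq_empty_iff] at hcon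
    have hnn : ∀ i, 0 ≤ d i * c i := fun i =>
      mul_nonneg (not_lt.1 (hcon (Finset.mem_univ i))) (hc i).le
    have hz := (Finset.sum_eq_zero_iff_of_nonneg (fun i _ => hnn i)).1
      (le_antisymm hdc (Finset.sum_nonneg fun i _ => hnn i))
    obtain ⟨i, hi⟩ := hdne
    exact hi ((mul_eq_zero.1 (hz i (Finset.mem_univ i))).resolve_right (hc i).ne')
  obtain ⟨i₀, hi₀, hmin⟩ := Finset.exists_min_image _ (fun i => L i / (- d i)) hneg
  have hdi₀ : d i₀ < 0 := (Finset.mem_filter.1 hi₀).2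
  let s := L i₀ / (- d i₀)
  have hs : 0 ≤ s := div_nonneg (hL _) (by linarith)
  have hnn : ∀ i, 0 ≤ L i + s * d i := by
    intro i
    rcases le_or_gt 0 (d i) with h | h
    · exact add_nonneg (hL i) (mul_nonneg hs h)
    · have := hmin i (by simpa using h)
      have h2 : s * (- d i) ≤ L i := (le_div_iff₀ (by linarith)).1 this
      linarith
  have hi₀zero : L i₀ + s * d i₀ = 0 := by
    simp only [s]
    field_simp [hdi₀.ne]
    ring
  have hlt : {i | L i + s * d i ≠ 0}.ncard < {i | L i ≠ 0}.ncard := by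
    apply Set.ncard_lt_ncard _ (Set.toFinite _)
    refine ⟨fun i hi hi' => hi ?_, fun hsub => hsub (a := i₀) ?_ hi₀zero⟩
    · simp [hi', hd0 i hi']
    · exact fun h => hdi₀.ne (hd0 _ h)
  obtain ⟨L', h1, h2, h3, h4⟩ := ih _ hlt _ hnn rfl
  refine ⟨L', h1, h2, ?_, ?_⟩
  · rw [h3]
    simp only [add_smul, mul_smul, Finset.sum_add_distrib, ← Finset.smul_sum, hdsum, smul_zero,
      add_zero]
  · refine h4.trans ?_
    simp only [add_mul, mul_assoc, Finset.sum_add_distrib, ← Finset.mul_sum]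
    have := mul_nonneg hs (neg_nonneg.2 hdc)
    linarith

/-- The conic combination of at most `finrank` vectors, indexed by `Fin`. -/
lemma exists_conic_combination_fin {ι E : Type*} [Fintype ι] [Nonempty ι] [AddCommGroup E]
    [Module ℝ E] [FiniteDimensional ℝ E] {m : ℕ} (hm : Module.finrank ℝ E = m)
    (a : ι → E) (c : ι → ℝ) (hc : ∀ i, 0 < c i) (L : ι → ℝ) (hL : ∀ i, 0 ≤ L i) :
    ∃ (L' : Fin m → ℝ) (e : Fin m → ι), (∀ i, 0 ≤ L' i) ∧
      ∑ i, L' i • a (e i) = ∑ i, L i • a i ∧ ∑ i, L' i * c (e i) ≤ ∑ i, L i * c i := by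
  classical
  obtain ⟨L₁, hL₁, hcard, hsum, hcost⟩ :=
    exists_conic_combination_card_le_finrank a c hc L hL
  rw [hm] at hcard
  let S := {i | L₁ i ≠ 0}
  have hS : Fintype.card S ≤ Fintype.card (Fin m) := by
    rwa [Fintype.card_fin, ← Nat.card_eq_fintype_card]
  obtain ⟨emb⟩ := Function.Embedding.nonempty_of_card_le hS
  let e : Fin m → ι := Function.extend emb Subtype.val (fun _ => Classical.arbitrary ι)
  let L' : Fin m → ℝ := Function.extend emb (fun i => L₁ i) 0
  have he : ∀ i, e (emb i) = i := fun i => emb.injective.extend_apply _ _ _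
  have hL' : ∀ i, L' (emb i) = L₁ i := fun i => emb.injective.extend_apply _ _ _
  have hL'0 : ∀ j, (¬ ∃ i, emb i = j) → L' j = 0 := fun j hj =>
    Function.extend_apply' _ _ _ hj
  have key : ∑ j, L' j • (a (e j), c (e j)) = ∑ i, L₁ i • (a i, c i) := by
    have h1 : ∑ j, L' j • (a (e j), c (e j)) = ∑ i : S, L₁ i • (a i, c i) := by
      symm
      apply Finset.sum_of_injOn emb emb.injective.injOn (by simp)
      · intro j _ hj
        rw [hL'0 j (by simpa using hj), zero_smul]
      · intro i _
        rw [hL', he]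
    rw [h1, ← Finset.sum_subtype (Finset.univ.filter fun i => L₁ i ≠ 0) (by simp [S])
      (fun i => L₁ i • (a i, c i))]
    apply Finset.sum_subset (Finset.subset_univ _)
    intro i _ hi
    rw [show L₁ i = 0 by simpa using hi, zero_smul]
  simp only [Prod.smul_mk, Prod.ext_iff, Prod.fst_sum, Prod.snd_sum, smul_eq_mul] at key
  refine ⟨L', e, ?_, key.1.trans hsum, key.2.trans_le hcost⟩
  intro j
  by_cases hj : ∃ i, emb i = j
  · obtain ⟨i, rfl⟩ := hj
    rw [hL']
    exact hL₁ _
  · rw [hL'0 j hj]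

lemma sum_le_varOn {X : Type*} (d : X → X → ℝ≥0∞) (f : ℝ → X) {S : Set ℝ} (k : ℕ)
    {u : ℕ → ℝ} (hu : Monotone u) (hS : ∀ i, u i ∈ S) :
    ∑ i ∈ Finset.range k, d (f (u (i + 1))) (f (u i)) ≤ varOn d f S :=
  le_iSup (fun p : ℕ × { u : ℕ → ℝ // Monotone u ∧ ∀ i, u i ∈ S } =>
    ∑ i ∈ Finset.range p.1, d (f (p.2.1 (i + 1))) (f (p.2.1 i))) ⟨k, u, hu, hS⟩

lemma varOn_mono {X : Type*} (d : X → X → ℝ≥0∞) (f : ℝ → X) {S T : Set ℝ} (h : S ⊆ T) :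
    varOn d f S ≤ varOn d f T :=
  iSup_le fun p => sum_le_varOn d f p.1 p.2.2.1 fun i => h (p.2.2.2 i)

/-- The variation up to time `t` exceeds the variation up to time `s ≤ t` by at least the
distance of the values. -/
lemma varOn_inter_Iic_add_le {X : Type*} (d : X → X → ℝ≥0∞) (f : ℝ → X) {S : Set ℝ} {s t : ℝ}
    (hst : s ≤ t) (hs : s ∈ S) (ht : t ∈ S) :
    varOn d f (S ∩ Iic s) + d (f t) (f s) ≤ varOn d f (S ∩ Iic t) := by
  have hne : Nonempty (ℕ × { u : ℕ → ℝ // Monotone u ∧ ∀ i, u i ∈ S ∩ Iic s }) :=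
    ⟨0, fun _ => s, monotone_const, fun _ => ⟨hs, le_refl s⟩⟩
  rw [varOn, ENNReal.iSup_add]
  refine iSup_le ?_
  rintro ⟨k, u, hu, hus⟩
  let v : ℕ → ℝ := fun i => if i ≤ k then u i else if i = k + 1 then s else t
  have hv : Monotone v := by
    refine monotone_nat_of_le_succ fun i => ?_
    simp only [v]
    have h1 := hu (Nat.le_succ i)
    have h2 := (hus i).2
    simp only [mem_Iic] at h2
    split_ifs <;> first | omega | assumption | exact le_rfl
  have hvS : ∀ i, v i ∈ S ∩ Iic t := by
    intro i
    simp only [v]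
    split_ifs
    · exact ⟨(hus i).1, (hus i).2.trans hst⟩
    · exact ⟨hs, hst⟩
    · exact ⟨ht, le_refl t⟩
  refine le_trans ?_ (sum_le_varOn d f (k + 2) hv hvS)
  rw [Finset.sum_range_succ, Finset.sum_range_succ]
  have hlast : d (f (v (k + 1 + 1))) (f (v (k + 1))) = d (f t) (f s) := by simp [v]
  rw [hlast]
  gcongr
  refine le_trans (le_of_eq ?_) le_self_add
  refine Finset.sum_congr rfl fun i hi => ?_
  have hi' := Finset.mem_range.1 hi
  simp [v, hi'.le, Nat.succ_le_of_lt hi']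

lemma dist_le_varOn {X : Type*} (d : X → X → ℝ≥0∞) (f : ℝ → X) {S : Set ℝ} {s t : ℝ}
    (hst : s ≤ t) (hs : s ∈ S) (ht : t ∈ S) : d (f t) (f s) ≤ varOn d f S :=
  le_add_self.trans ((varOn_inter_Iic_add_le d f hst hs ht).trans
    (varOn_mono d f inter_subset_left))

/-- The variation up to time `t`, as a real number. -/
def cumVar {X : Type*} (d : X → X → ℝ≥0∞) (f : ℝ → X) (t : ℝ) : ℝ :=
  (varOn d f (unitI ∩ Iic t)).toReal

section cumVar

variable {X : Type*} {d : X → X → ℝ≥0∞} {f : ℝ → X}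

lemma varOn_inter_ne_top (hf : varOn d f unitI ≠ ⊤) (t : ℝ) :
    varOn d f (unitI ∩ Iic t) ≠ ⊤ :=
  ne_top_of_le_ne_top hf (varOn_mono d f inter_subset_left)

lemma cumVar_mono (hf : varOn d f unitI ≠ ⊤) : Monotone (cumVar d f) := fun _ t hst =>
  ENNReal.toReal_mono (varOn_inter_ne_top hf t)
    (varOn_mono d f (inter_subset_inter_right _ (Iic_subset_Iic.2 hst)))

lemma cumVar_mem_Icc {C : ℝ≥0} (hf : varOn d f unitI ≤ C) (t : ℝ) :
    cumVar d f t ∈ Icc (0 : ℝ) C :=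
  ⟨ENNReal.toReal_nonneg, ENNReal.toReal_le_coe_of_le_coe
    ((varOn_mono d f inter_subset_left).trans hf)⟩

lemma dist_le_cumVar_sub (hf : varOn d f unitI ≠ ⊤) {s t : ℝ} (hst : s ≤ t) (hs : s ∈ unitI)
    (ht : t ∈ unitI) : d (f t) (f s) ≤ ENNReal.ofReal (cumVar d f t - cumVar d f s) := by
  rw [cumVar, cumVar, ENNReal.ofReal_sub _ ENNReal.toReal_nonneg,
    ENNReal.ofReal_toReal (varOn_inter_ne_top hf t),
    ENNReal.ofReal_toReal (varOn_inter_ne_top hf s)]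
  exact ENNReal.le_sub_of_add_le_left (varOn_inter_ne_top hf s)
    (varOn_inter_Iic_add_le d f hst hs ht)

end cumVar

/-- **Helly's selection theorem** for curves in a compact metric space. -/
lemma exists_subseq_tendsto_of_varOn_le {Z : Type*} [MetricSpace Z] [CompactSpace Z]
    (x : ℕ → ℝ → Z) (C : ℝ≥0) (hx : ∀ j, varOn (fun a b : Z => edist a b) (x j) unitI ≤ C) :
    ∃ (φ : ℕ → ℕ) (y : ℝ → Z), StrictMono φ ∧
      ∀ t ∈ unitI, Tendsto (fun j => x (φ j) t) atTop (𝓝 (y t)) := by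
  have hx' : ∀ j, varOn (fun a b : Z => edist a b) (x j) unitI ≠ ⊤ := fun j =>
    ne_top_of_le_ne_top ENNReal.coe_ne_top (hx j)
  let 𝒰 : Ultrafilter ℕ := hyperfilter ℕ
  have hU : (𝒰 : Filter ℕ) ≤ atTop := Nat.hyperfilter_le_atTop
  let V : ℕ → ℝ → ℝ := fun j => cumVar (fun a b : Z => edist a b) (x j)
  have hlimx : ∀ t, ∃ z, Tendsto (fun j => x j t) 𝒰 (𝓝 z) := by
    intro t
    obtain ⟨z, -, hz⟩ := isCompact_univ.ultrafilter_le_nhds (𝒰.map fun j => x j t) (by simp)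
    exact ⟨z, hz⟩
  have hlimV : ∀ t, ∃ r, Tendsto (fun j => V j t) 𝒰 (𝓝 r) := by
    intro t
    obtain ⟨z, -, hz⟩ := (isCompact_Icc (a := (0 : ℝ)) (b := C)).ultrafilter_le_nhds
      (𝒰.map fun j => V j t) (by
        rw [le_principal_iff]
        change ∀ᶠ j in (𝒰 : Filter ℕ), V j t ∈ Icc (0 : ℝ) C
        exact Eventually.of_forall fun j => cumVar_mem_Icc (hx j) t)
    exact ⟨z, hz⟩
  choose y hy using hlimx
  choose W hW using hlimV
  have hWmono : Monotone W := fun s t hst =>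
    le_of_tendsto_of_tendsto' (hW s) (hW t) fun j => cumVar_mono (hx' j) hst
  have hdistV : ∀ j, ∀ s ∈ unitI, ∀ t ∈ unitI, s ≤ t →
      dist (x j t) (x j s) ≤ V j t - V j s := by
    intro j s hs t ht hst
    have h := dist_le_cumVar_sub (hx' j) hst hs ht
    rwa [edist_le_ofReal (sub_nonneg.2 (cumVar_mono (hx' j) hst))] at h
  have hdistW : ∀ s ∈ unitI, ∀ t ∈ unitI, s ≤ t → dist (y t) (y s) ≤ W t - W s := by
    intro s hs t ht hst
    exact le_of_tendsto_of_tendsto' ((hy t).dist (hy s)) ((hW t).sub (hW s))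
      fun j => hdistV j s hs t ht hst
  let D : Set ℝ := (range ((↑) : ℚ → ℝ) ∪ {0, 1}) ∪ {t | ¬ ContinuousAt W t}
  have hD : D.Countable :=
    ((countable_range _).union (Set.toFinite _).countable).union
      hWmono.countable_not_continuousAt
  have : Countable D := hD.to_subtype
  let G : ℕ → (D → Z × ℝ) := fun j t => (x j t, V j t)
  have hG : Tendsto G 𝒰 (𝓝 fun t => (y t, W t)) :=
    tendsto_pi_nhds.2 fun t => (hy t).prodMk_nhds (hW t)
  have hcl : MapClusterPt (fun t : D => (y t, W t)) atTop G :=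
    hG.mapClusterPt.mono hU
  obtain ⟨φ, hφ, hlim⟩ := hcl.tendsto_subseq
  have hlim' := fun t : D => tendsto_pi_nhds.1 hlim t
  have hxD : ∀ t ∈ D, Tendsto (fun j => x (φ j) t) atTop (𝓝 (y t)) := fun t ht =>
    (continuous_fst.tendsto _).comp (hlim' ⟨t, ht⟩)
  have hVD : ∀ t ∈ D, Tendsto (fun j => V (φ j) t) atTop (𝓝 (W t)) := fun t ht =>
    (continuous_snd.tendsto _).comp (hlim' ⟨t, ht⟩)
  refine ⟨φ, y, hφ, fun t ht => ?_⟩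
  by_cases htD : t ∈ D
  · exact hxD t htD
  have hcont : ContinuousAt W t := by
    by_contra h
    exact htD (Or.inr h)
  have ht0 : 0 < t := lt_of_le_of_ne ht.1 fun h => htD (Or.inl (Or.inr (by simp [← h])))
  have ht1 : t < 1 := lt_of_le_of_ne ht.2 fun h => htD (Or.inl (Or.inr (by simp [h])))
  rw [Metric.tendsto_atTop']
  intro ε hε
  obtain ⟨δ, hδ, hWδ⟩ := Metric.continuousAt_iff.1 hcont (ε / 6) (by positivity)
  obtain ⟨q, hq1, hq2⟩ := exists_rat_btwn (max_lt ht0 (sub_lt_self t hδ))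
  obtain ⟨q', hq1', hq2'⟩ := exists_rat_btwn (lt_min ht1 (lt_add_of_pos_right t hδ))
  rw [max_lt_iff] at hq1
  rw [lt_min_iff] at hq2'
  have hqI : (q : ℝ) ∈ unitI := ⟨hq1.1.le, by linarith⟩
  have hqI' : (q' : ℝ) ∈ unitI := ⟨by linarith, hq2'.1.le⟩
  have hqD : (q : ℝ) ∈ D := Or.inl (Or.inl ⟨q, rfl⟩)
  have hqD' : (q' : ℝ) ∈ D := Or.inl (Or.inl ⟨q', rfl⟩)
  have hWq := hWδ (x := q) (by rw [Real.dist_eq, abs_lt]; constructor <;> linarith)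
  have hWq' := hWδ (x := q') (by rw [Real.dist_eq, abs_lt]; constructor <;> linarith)
  rw [Real.dist_eq, abs_lt] at hWq hWq'
  have hgap : W q' - W q < ε / 3 := by linarith [hWq.1, hWq'.2]
  have ev1 := ((hVD q' hqD').sub (hVD q hqD)).eventually_lt_const hgap
  have ev2 := (Metric.tendsto_nhds.1 (hxD q hqD)) (ε / 3) (by positivity)
  obtain ⟨N, hN⟩ := eventually_atTop.1 (ev1.and ev2)
  refine ⟨N, fun j hj => ?_⟩
  obtain ⟨h1, h2⟩ := hN j hj.le
  have h3 : dist (x (φ j) t) (x (φ j) q) ≤ V (φ j) t - V (φ j) q :=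
    hdistV _ _ hqI _ ht hq2.le
  have h4 : V (φ j) t ≤ V (φ j) q' := cumVar_mono (hx' _) hq1'.le
  have h5 := hdistW _ hqI _ ht hq2.le
  have h6 := hWmono hq1'.le
  have h7 := dist_triangle4 (x (φ j) t) (x (φ j) q) (y q) (y t)
  rw [dist_comm (y q)] at h7
  linarith

lemma varOn_const {X : Type*} [PseudoEMetricSpace X] (a : X) (S : Set ℝ) :
    varOn (fun a b : X => edist a b) (fun _ => a) S = 0 := by
  simp [varOn]

/-- The curve of measures `t ↦ ∑ i, L i • δ_{x i t}`. -/
def diracCurve {ι X : Type*} [Fintype ι] [MeasurableSpace X] (L : ι → ℝ) (x : ι → ℝ → X) :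
    ℝ → Measure X :=
  fun t => ∑ i, ENNReal.ofReal (L i) • Measure.dirac (x i t)

/-- The regularization cost of a family of weighted curves. -/
def curveCost {ι X : Type*} [Fintype ι] [PseudoEMetricSpace X] (α β : ℝ) (L : ι → ℝ)
    (x : ι → ℝ → X) : ℝ :=
  ∑ i, L i * (α + β * (varOn (fun a b : X => edist a b) (x i) unitI).toReal)

lemma essVar_le_varOn {X : Type*} (d : X → X → ℝ≥0∞) (f : ℝ → X) :
    essVar d f ≤ varOn d f unitI :=
  iInf₂_le_of_le f (ae_of_all (volume.restrict unitI) fun _ => rfl) le_rfl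

lemma diracCurve_univ {ι X : Type*} [Fintype ι] [MeasurableSpace X] (L : ι → ℝ)
    (hL : ∀ i, 0 ≤ L i) (x : ι → ℝ → X) (t : ℝ) :
    diracCurve L x t univ = ENNReal.ofReal (∑ i, L i) := by
  simp [diracCurve, ENNReal.ofReal_sum_of_nonneg fun i _ => hL i]

section diracCurve

variable {ι X : Type*} [Fintype ι] [MetricSpace X] [CompactSpace X] [MeasurableSpace X]
  [BorelSpace X]

lemma W1_sum_dirac_le (l : ι → ℝ≥0∞) (x y : ι → X) :
    W1 (∑ i, l i • Measure.dirac (x i)) (∑ i, l i • Measure.dirac (y i))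
      ≤ ∑ i, l i * edist (x i) (y i) := by
  refine iInf₂_le_of_le (∑ i, l i • Measure.dirac (x i, y i)) ⟨?_, ?_⟩ ?_
  · rw [Measure.map_finset_sum (by fun_prop)]
    simp [Measure.map_smul, Measure.map_dirac' measurable_fst]
  · rw [Measure.map_finset_sum (by fun_prop)]
    simp [Measure.map_smul, Measure.map_dirac' measurable_snd]
  · rw [lintegral_finsetSum_measure]
    simp [lintegral_smul_measure]

lemma varOn_diracCurve_le (L : ι → ℝ) (x : ι → ℝ → X) (S : Set ℝ) :
    varOn W1M (diracCurve L x) S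
      ≤ ∑ i, ENNReal.ofReal (L i) * varOn (fun a b : X => edist a b) (x i) S := by
  refine iSup_le ?_
  rintro ⟨k, u, hu, huS⟩
  calc _ ≤ ∑ j ∈ Finset.range k, ∑ i, ENNReal.ofReal (L i) *
          edist (x i (u (j + 1))) (x i (u j)) :=
        Finset.sum_le_sum fun j _ => W1_sum_dirac_le _ _ _
    _ = ∑ i, ENNReal.ofReal (L i) *
          ∑ j ∈ Finset.range k, edist (x i (u (j + 1))) (x i (u j)) := by
        rw [Finset.sum_comm]
        simp_rw [Finset.mul_sum]
    _ ≤ _ := by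
        gcongr with i
        exact sum_le_varOn (fun a b : X => edist a b) (x i) k hu huS

lemma integral_diracCurve (L : ι → ℝ) (hL : ∀ i, 0 ≤ L i) (x : ι → ℝ → X) (t : ℝ)
    (φ : C(X, ℝ)) : ∫ z, φ z ∂(diracCurve L x t) = ∑ i, L i * φ (x i t) := by
  rw [diracCurve, integral_finsetSum_measure]
  · simp [integral_smul_measure, hL]
  · intro i _
    exact (integrable_dirac (by simp)).smul_measure ENNReal.ofReal_ne_top

lemma varOn_diracCurve_ne_top (L : ι → ℝ) (x : ι → ℝ → X)
    (hx : ∀ i, varOn (fun a b : X => edist a b) (x i) unitI ≠ ⊤) :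
    varOn W1M (diracCurve L x) unitI ≠ ⊤ :=
  ne_top_of_le_ne_top
    (ENNReal.sum_ne_top.2 fun i _ => ENNReal.mul_ne_top ENNReal.ofReal_ne_top (hx i))
    (varOn_diracCurve_le L x unitI)

/-- Families of weighted curves of bounded cost are sequentially compact, and the cost is lower
semicontinuous. -/
lemma exists_subseq_tendsto_diracCurve [Nonempty X] {α β : ℝ} (hα : 0 < α) (hβ : 0 < β)
    (L : ℕ → ι → ℝ) (x : ℕ → ι → ℝ → X) (hL : ∀ j i, 0 ≤ L j i)
    (hx : ∀ j i, varOn (fun a b : X => edist a b) (x j i) unitI ≠ ⊤)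
    (b : ℕ → ℝ) (c : ℝ) (hb : Tendsto b atTop (𝓝 c))
    (hcost : ∀ j, curveCost α β (L j) (x j) ≤ b j) :
    ∃ (φ : ℕ → ℕ) (L' : ι → ℝ) (x' : ι → ℝ → X), StrictMono φ ∧ (∀ i, 0 ≤ L' i) ∧
      (∀ i, varOn (fun a b : X => edist a b) (x' i) unitI ≠ ⊤) ∧
      curveCost α β L' x' ≤ c ∧
      ∀ t ∈ unitI, WStarTendsto (fun j => diracCurve (L (φ j)) (x (φ j)) t)
        (diracCurve L' x' t) := by
  classical
  let Var : ℕ → ι → ℝ := fun j i =>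
    (varOn (fun a b : X => edist a b) (x j i) unitI).toReal
  let u : ℕ → ι → ℝ := fun j i => L j i * Var j i
  have hu : ∀ j i, 0 ≤ u j i := fun j i => mul_nonneg (hL j i) ENNReal.toReal_nonneg
  have hcost_eq : ∀ j, curveCost α β (L j) (x j) = ∑ i, (α * L j i + β * u j i) := by
    intro j
    refine Finset.sum_congr rfl fun i _ => ?_
    simp only [u, Var]
    ring
  obtain ⟨C, hC⟩ := hb.bddAbove_range
  have hterm : ∀ j i, α * L j i + β * u j i ≤ C := by
    intro j i
    refine le_trans ?_ ((hcost_eq j).ge.trans ((hcost j).trans (hC ⟨j, rfl⟩)))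
    exact Finset.single_le_sum (f := fun i => α * L j i + β * u j i)
      (fun i _ => add_nonneg (mul_nonneg hα.le (hL j i)) (mul_nonneg hβ.le (hu j i)))
      (Finset.mem_univ i)
  have hbox : ∀ j, (L j, u j) ∈ Icc (0 : ι → ℝ) (fun _ => C / α) ×ˢ
      Icc (0 : ι → ℝ) (fun _ => C / β) := by
    intro j
    refine ⟨⟨hL j, fun i => ?_⟩, ⟨hu j, fun i => ?_⟩⟩
    · rw [le_div_iff₀ hα]
      nlinarith [hterm j i, mul_nonneg hβ.le (hu j i)]
    · rw [le_div_iff₀ hβ]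
      nlinarith [hterm j i, mul_nonneg hα.le (hL j i)]
  obtain ⟨⟨L', u'⟩, ⟨⟨hL'0, -⟩, ⟨hu'0, -⟩⟩, φ₁, hφ₁, hlim⟩ :=
    (isCompact_Icc.prod isCompact_Icc).tendsto_subseq hbox
  have hLlim : ∀ i, Tendsto (fun j => L (φ₁ j) i) atTop (𝓝 (L' i)) := fun i =>
    tendsto_pi_nhds.1 ((continuous_fst.tendsto _).comp hlim) i
  have hulim : ∀ i, Tendsto (fun j => u (φ₁ j) i) atTop (𝓝 (u' i)) := fun i =>
    tendsto_pi_nhds.1 ((continuous_snd.tendsto _).comp hlim) i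
  have hVarlim : ∀ i, L' i ≠ 0 → Tendsto (fun j => Var (φ₁ j) i) atTop (𝓝 (u' i / L' i)) := by
    intro i hi
    refine ((hulim i).div (hLlim i) hi).congr' ?_
    filter_upwards [(hLlim i).eventually_ne hi] with j hj
    simp only [Pi.div_apply, u]
    field_simp
  let x₀ : X := Classical.arbitrary X
  let z : ℕ → ι → ℝ → X := fun j i => if L' i = 0 then fun _ => x₀ else x (φ₁ j) i
  have hzbound : ∀ i, ∃ v : ℝ≥0, ∀ j, varOn (fun a b : X => edist a b) (z j i) unitI ≤ v := by
    intro i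
    by_cases hi : L' i = 0
    · exact ⟨0, fun j => by simp [z, hi, varOn_const]⟩
    · obtain ⟨v, hv⟩ := (hVarlim i hi).bddAbove_range
      refine ⟨v.toNNReal, fun j => ?_⟩
      simp only [z, hi, if_false]
      rw [← ENNReal.ofReal_toReal (hx (φ₁ j) i)]
      exact ENNReal.ofReal_le_ofReal (hv ⟨j, rfl⟩)
  choose v hv using hzbound
  obtain ⟨φ₂, y, hφ₂, hy⟩ := exists_subseq_tendsto_of_varOn_le (Z := ι → X)
    (fun j t i => z j i t) (∑ i, v i) (by
      intro j
      refine iSup_le ?_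
      rintro ⟨k, s, hs, hsS⟩
      calc _ ≤ ∑ l ∈ Finset.range k, ∑ i, edist (z j i (s (l + 1))) (z j i (s l)) := by
            refine Finset.sum_le_sum fun l _ => edist_pi_le_iff.2 fun i => ?_
            exact Finset.single_le_sum
              (f := fun i => edist (z j i (s (l + 1))) (z j i (s l)))
              (fun _ _ => zero_le) (Finset.mem_univ i)
        _ = ∑ i, ∑ l ∈ Finset.range k, edist (z j i (s (l + 1))) (z j i (s l)) :=
            Finset.sum_comm
        _ ≤ ∑ i, (v i : ℝ≥0∞) := Finset.sum_le_sum fun i _ =>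
            (sum_le_varOn (fun a b : X => edist a b) (z j i) k hs hsS).trans (hv i j)
        _ = _ := by push_cast; rfl)
  let x' : ι → ℝ → X := fun i => if L' i = 0 then fun _ => x₀ else fun t => y t i
  have hxlim : ∀ i, L' i ≠ 0 → ∀ t ∈ unitI,
      Tendsto (fun j => x (φ₁ (φ₂ j)) i t) atTop (𝓝 (x' i t)) := by
    intro i hi t ht
    have := tendsto_pi_nhds.1 (hy t ht) i
    simpa [z, x', hi] using this
  have hx'var : ∀ i, L' i ≠ 0 →
      varOn (fun a b : X => edist a b) (x' i) unitI ≤ ENNReal.ofReal (u' i / L' i) := by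
    intro i hi
    refine le_of_forall_lt fun r hr => ?_
    obtain ⟨r', hrr', hr'⟩ := exists_between hr
    refine hrr'.trans_le (ge_of_tendsto ((ENNReal.continuous_ofReal.tendsto _).comp
      ((hVarlim i hi).comp hφ₂.tendsto_atTop)) ?_)
    have h2 := eVariationOn.lowerSemicontinuous_aux (s := unitI) (p := atTop)
      (F := fun j => x (φ₁ (φ₂ j)) i) (hxlim i hi) (v := r') hr'
    filter_upwards [h2] with j hj
    simp only [Function.comp_apply, Var]
    rw [ENNReal.ofReal_toReal (hx _ i)]
    exact hj.le
  refine ⟨φ₁ ∘ φ₂, L', x', hφ₁.comp hφ₂, hL'0, ?_, ?_, ?_⟩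
  · intro i
    by_cases hi : L' i = 0
    · simp [x', hi, varOn_const]
    · exact ne_top_of_le_ne_top ENNReal.ofReal_ne_top (hx'var i hi)
  · have h1 : curveCost α β L' x' ≤ ∑ i, (α * L' i + β * u' i) := by
      refine Finset.sum_le_sum fun i _ => ?_
      by_cases hi : L' i = 0
      · simpa [hi] using mul_nonneg hβ.le (hu'0 i)
      · have hpos : 0 < L' i := lt_of_le_of_ne (hL'0 i) (Ne.symm hi)
        have h2 := ENNReal.toReal_le_of_le_ofReal (div_nonneg (hu'0 i) hpos.le) (hx'var i hi)
        rw [le_div_iff₀ hpos] at h2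
        nlinarith
    have h2 := tendsto_finsetSum Finset.univ fun i _ =>
      ((hLlim i).const_mul α).add ((hulim i).const_mul β)
    refine h1.trans (le_of_tendsto_of_tendsto' h2 (hb.comp hφ₁.tendsto_atTop) ?_)
    intro j
    rw [← hcost_eq]
    exact hcost _
  · intro t ht ψ
    simp only [integral_diracCurve _ (hL _), integral_diracCurve _ hL'0]
    refine tendsto_finsetSum _ fun i _ => ?_
    have hLi := (hLlim i).comp hφ₂.tendsto_atTop
    by_cases hi : L' i = 0
    · rw [hi, zero_mul]
      rw [hi] at hLi
      refine hLi.zero_mul_isBoundedUnder_le ?_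
      exact isBoundedUnder_of ⟨‖ψ‖, fun j => ψ.norm_coe_le_norm _⟩
    · exact hLi.mul ((ψ.continuous.tendsto _).comp (hxlim i hi t ht))

end diracCurve

section Admissible

variable {ι : Type*} [Fintype ι] {n : ℕ} {Ω : Set (EuclideanSpace ℝ (Fin n))}
  [CompactSpace ↥Ω]

lemma diracCurve_mem_Adm [Nonempty ↥Ω] (L : ι → ℝ) (hL : ∀ i, 0 ≤ L i) (x : ι → ℝ → ↥Ω)
    (hx : ∀ i, varOn (fun a b : ↥Ω => edist a b) (x i) unitI ≠ ⊤) :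
    diracCurve L x ∈ Adm Ω := by
  have hM : 0 ≤ ∑ i, L i := Finset.sum_nonneg fun i _ => hL i
  rcases hM.eq_or_lt with h0 | hpos
  · refine ⟨0, fun _ => ⟨Measure.dirac (Classical.arbitrary ↥Ω), inferInstance⟩, ?_, ?_⟩
    · refine (essVar_le_varOn _ _).trans_lt (lt_top_iff_ne_top.2 ?_)
      have h := varOn_diracCurve_ne_top (fun _ : Unit => (1 : ℝ))
        (fun _ _ => Classical.arbitrary ↥Ω) (by simp [varOn_const])
      simpa [diracCurve, varOn, W1M, W1P] using h
    · intro t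
      have hz := (Finset.sum_eq_zero_iff_of_nonneg fun i _ => hL i).1 h0.symm
      simp [diracCurve, Finset.sum_eq_zero, hz]
  · have hL' : ∀ i, 0 ≤ L i / ∑ i, L i := fun i => div_nonneg (hL i) hM
    refine ⟨(∑ i, L i).toNNReal, fun t => ⟨diracCurve (fun i => L i / ∑ i, L i) x t, ⟨?_⟩⟩,
      ?_, ?_⟩
    · rw [diracCurve_univ _ hL', ← Finset.sum_div, div_self hpos.ne', ENNReal.ofReal_one]
    · exact (essVar_le_varOn _ _).trans_lt
        (lt_top_iff_ne_top.2 (varOn_diracCurve_ne_top (fun i => L i / ∑ i, L i) x hx))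
    · intro t
      change diracCurve L x t = ENNReal.ofReal (∑ i, L i) •
        diracCurve (fun i => L i / ∑ i, L i) x t
      simp only [diracCurve, Finset.smul_sum, smul_smul]
      refine Finset.sum_congr rfl fun i _ => ?_
      rw [← ENNReal.ofReal_mul hM, mul_div_cancel₀ _ hpos.ne']

lemma Reg_diracCurve_le {α β : ℝ} (hβ : 0 < β) (L : ι → ℝ) (hL : ∀ i, 0 ≤ L i)
    (x : ι → ℝ → ↥Ω) (hx : ∀ i, varOn (fun a b : ↥Ω => edist a b) (x i) unitI ≠ ⊤) :
    Reg α β (diracCurve L x) ≤ curveCost α β L x := by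
  have h1 : (essVar W1M (diracCurve L x)).toReal
      ≤ ∑ i, L i * (varOn (fun a b : ↥Ω => edist a b) (x i) unitI).toReal := by
    have hfin : ∀ i ∈ Finset.univ, ENNReal.ofReal (L i) *
        varOn (fun a b : ↥Ω => edist a b) (x i) unitI ≠ ⊤ := fun i _ =>
      ENNReal.mul_ne_top ENNReal.ofReal_ne_top (hx i)
    refine (ENNReal.toReal_mono (ENNReal.sum_ne_top.2 hfin)
      ((essVar_le_varOn _ _).trans (varOn_diracCurve_le L x unitI))).trans_eq ?_
    rw [ENNReal.toReal_sum hfin]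
    simp [hL]
  rw [Reg, wt, diracCurve_univ L hL, ENNReal.toReal_ofReal (Finset.sum_nonneg fun i _ => hL i)]
  calc _ ≤ α * ∑ i, L i
        + β * ∑ i, L i * (varOn (fun a b : ↥Ω => edist a b) (x i) unitI).toReal := by gcongr
    _ = _ := by
      rw [curveCost, Finset.mul_sum, Finset.mul_sum, ← Finset.sum_add_distrib]
      exact Finset.sum_congr rfl fun i _ => by ring

lemma toFunc_diracCurve (L : ι → ℝ) (hL : ∀ i, 0 ≤ L i) (x : ι → ℝ → ↥Ω) :
    toFunc (diracCurve L x) = ∑ i, L i • fun (t : ℝ) (φ : C(↥Ω, ℝ)) => φ (x i t) := by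
  ext t φ
  simp [toFunc, integral_diracCurve L hL]

end Admissible

section Coupling

variable {X : Type*} [MeasurableSpace X]

lemma W1_smul_le [PseudoEMetricSpace X] (c : ℝ≥0) (μ ν : Measure X) :
    W1 ((c : ℝ≥0∞) • μ) ((c : ℝ≥0∞) • ν) ≤ c * W1 μ ν := by
  rcases eq_or_ne c 0 with rfl | hc
  · exact iInf₂_le_of_le 0 ⟨by simp, by simp⟩ (by simp)
  rw [← ENNReal.inv_mul_le_iff (by simpa using hc) ENNReal.coe_ne_top]
  refine le_iInf₂ fun π hπ => ?_
  rw [ENNReal.inv_mul_le_iff (by simpa using hc) ENNReal.coe_ne_top]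
  refine iInf₂_le_of_le ((c : ℝ≥0∞) • π) ⟨?_, ?_⟩
    (by rw [lintegral_smul_measure, smul_eq_mul])
  · rw [Measure.map_smul, hπ.1]
  · rw [Measure.map_smul, hπ.2]

lemma measure_univ_eq_of_W1_ne_top [PseudoEMetricSpace X] {μ ν : Measure X}
    (h : W1 μ ν ≠ ⊤) : μ univ = ν univ := by
  simp only [W1, ne_eq, iInf_eq_top, not_forall] at h
  obtain ⟨π, ⟨h1, h2⟩, -⟩ := h
  rw [← h1, ← h2, Measure.map_apply measurable_fst .univ, Measure.map_apply measurable_snd .univ]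
  rfl

lemma IsCoupling.real_univ {μ ν : Measure X} {π : Measure (X × X)} (h : IsCoupling μ ν π) :
    π.real univ = μ.real univ := by
  rw [← h.1, Measure.real, Measure.real, Measure.map_apply measurable_fst .univ]
  rfl

variable [MetricSpace X] [CompactSpace X] [BorelSpace X]

lemma exists_coupling_integral_dist_le {μ ν : Measure X} [IsFiniteMeasure μ]
    (h : W1 μ ν ≠ ⊤) {ε : ℝ} (hε : 0 < ε) :
    ∃ π : Measure (X × X), IsFiniteMeasure π ∧ IsCoupling μ ν π ∧
      ∫ q, dist q.1 q.2 ∂π ≤ (W1 μ ν).toReal + ε := by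
  have hlt : W1 μ ν < W1 μ ν + ENNReal.ofReal ε :=
    ENNReal.lt_add_right h (by simpa using hε)
  obtain ⟨π, hπ, hcost⟩ : ∃ π, ∃ _ : π ∈ {π | IsCoupling μ ν π},
      ∫⁻ q, edist q.1 q.2 ∂π < W1 μ ν + ENNReal.ofReal ε := by
    conv_lhs at hlt => rw [W1]
    simpa only [iInf_lt_iff] using hlt
  refine ⟨π, ⟨?_⟩, hπ, ?_⟩
  · have : π univ = μ univ := by
      rw [← hπ.1, Measure.map_apply measurable_fst .univ]
      rfl
    rw [this]
    exact measure_lt_top _ _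
  · rw [integral_eq_lintegral_of_nonneg_ae (ae_of_all _ fun _ => dist_nonneg)
      (by fun_prop)]
    simp only [← edist_dist]
    rw [← ENNReal.toReal_ofReal hε.le, ← ENNReal.toReal_add h ENNReal.ofReal_ne_top]
    exact ENNReal.toReal_mono (by finiteness) hcost.le

lemma integrable_of_continuous {Z : Type*} [TopologicalSpace Z] [CompactSpace Z]
    [MeasurableSpace Z] [OpensMeasurableSpace Z] {μ : Measure Z} [IsFiniteMeasure μ]
    {f : Z → ℝ} (hf : Continuous f) : Integrable f μ :=
  hf.integrable_of_hasCompactSupport (HasCompactSupport.of_compactSpace f)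

/-- Integrals of a fixed continuous function are controlled by the Wasserstein distance. -/
lemma exists_abs_integral_sub_le (φ : C(X, ℝ)) {η : ℝ} (hη : 0 < η) :
    ∃ C : ℝ, 0 ≤ C ∧ ∀ μ ν : Measure X, IsFiniteMeasure μ → W1 μ ν ≠ ⊤ →
      |∫ x, φ x ∂μ - ∫ x, φ x ∂ν| ≤ η * μ.real univ + C * (W1 μ ν).toReal := by
  obtain ⟨δ, hδ, hφ⟩ := Metric.uniformContinuous_iff.1
    (CompactSpace.uniformContinuous_of_continuous φ.continuous) η hη
  have hC : 0 ≤ 2 * ‖φ‖ / δ := by positivity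
  refine ⟨2 * ‖φ‖ / δ, hC, fun μ ν hμ h => ?_⟩
  have hpt : ∀ x y, |φ x - φ y| ≤ η + 2 * ‖φ‖ / δ * dist x y := by
    intro x y
    rcases lt_or_ge (dist x y) δ with hxy | hxy
    · have h1 : |φ x - φ y| < η := hφ hxy
      have h2 := mul_nonneg hC (dist_nonneg (x := x) (y := y))
      linarith
    · have h1 : |φ x - φ y| ≤ ‖φ‖ + ‖φ‖ :=
        (abs_sub _ _).trans (add_le_add (φ.norm_coe_le_norm x) (φ.norm_coe_le_norm y))
      have h2 : 2 * ‖φ‖ ≤ 2 * ‖φ‖ / δ * dist x y := by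
        rw [div_mul_eq_mul_div, le_div_iff₀ hδ]
        gcongr
      linarith
  have key : ∀ ε : ℝ, 0 < ε → |∫ x, φ x ∂μ - ∫ x, φ x ∂ν|
      ≤ η * μ.real univ + 2 * ‖φ‖ / δ * ((W1 μ ν).toReal + ε) := by
    intro ε hε
    obtain ⟨π, _, hπ, hcost⟩ := exists_coupling_integral_dist_le h hε
    have hd : Integrable (fun q : X × X => dist q.1 q.2) π :=
      integrable_of_continuous (by fun_prop)
    have e1 : ∫ x, φ x ∂μ = ∫ q, φ q.1 ∂π := by
      rw [← hπ.1, integral_map (by fun_prop) (by fun_prop)]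
    have e2 : ∫ x, φ x ∂ν = ∫ q, φ q.2 ∂π := by
      rw [← hπ.2, integral_map (by fun_prop) (by fun_prop)]
    rw [e1, e2, ← integral_sub (integrable_of_continuous (by fun_prop))
      (integrable_of_continuous (by fun_prop))]
    calc _ ≤ ∫ q, |φ q.1 - φ q.2| ∂π := abs_integral_le_integral_abs
      _ ≤ ∫ q, (η + 2 * ‖φ‖ / δ * dist q.1 q.2) ∂π :=
          integral_mono (integrable_of_continuous (by fun_prop))
            ((integrable_const _).add (hd.const_mul _)) fun q => hpt _ _
      _ = η * μ.real univ + 2 * ‖φ‖ / δ * ∫ q, dist q.1 q.2 ∂π := by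
          rw [integral_add (integrable_const _) (hd.const_mul _), integral_const,
            integral_const_mul, hπ.real_univ, smul_eq_mul, mul_comm η]
      _ ≤ _ := by gcongr
  refine ge_of_tendsto (x := 𝓝[>] (0 : ℝ)) ?_
    (eventually_nhdsWithin_of_forall fun ε hε => key ε hε)
  refine Tendsto.mono_left ?_ nhdsWithin_le_nhds
  have : Continuous fun ε : ℝ => η * μ.real univ + 2 * ‖φ‖ / δ * ((W1 μ ν).toReal + ε) := by
    fun_prop
  simpa using this.tendsto 0

end Coupling

section Discretization

variable {X : Type*} [MetricSpace X] [CompactSpace X] [MeasurableSpace X] [BorelSpace X]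

/-- A compact metric space can be quantized measurably up to any accuracy. -/
lemma exists_measurable_quantization [Nonempty X] {ε : ℝ} (hε : 0 < ε) :
    ∃ (N : ℕ) (P : X → Fin (N + 1)) (r : Fin (N + 1) → X), Measurable P ∧
      ∀ z, dist (r (P z)) z ≤ ε := by
  let e := TopologicalSpace.denseSeq X
  obtain ⟨s, hs⟩ := isCompact_univ.elim_finite_subcover (fun k => Metric.ball (e k) ε)
    (fun k => Metric.isOpen_ball) (fun z _ => by
      obtain ⟨k, hk⟩ := (TopologicalSpace.denseRange_denseSeq X).exists_dist_lt z hε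
      exact mem_iUnion.2 ⟨k, hk⟩)
  let N := s.sup id
  refine ⟨N, fun z => ⟨SimpleFunc.nearestPtInd e N z,
    Nat.lt_succ_of_le (SimpleFunc.nearestPtInd_le e N z)⟩, fun i => e i, ?_, fun z => ?_⟩
  · refine measurable_to_countable' fun i => ?_
    convert (SimpleFunc.nearestPtInd e N).measurableSet_fiber i using 1
    ext z
    simp [Fin.ext_iff]
  · obtain ⟨k, hk, hz⟩ := mem_iUnion₂.1 (hs (mem_univ z))
    have h := SimpleFunc.edist_nearestPt_le e z (Finset.le_sup (f := id) hk)
    rw [edist_dist, edist_dist, ENNReal.ofReal_le_ofReal_iff dist_nonneg] at h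
    rw [Metric.mem_ball, dist_comm] at hz
    exact h.trans hz.le

lemma sum_measureReal_pair_snd {A B : Type*} [Fintype A] [Fintype B] [MeasurableSpace A]
    [MeasurableSpace B] [MeasurableSingletonClass A] [MeasurableSingletonClass B]
    (κ : Measure (A × B)) [IsFiniteMeasure κ] (b : B) :
    ∑ a, κ.real {(a, b)} = (κ.map Prod.snd).real {b} := by
  classical
  rw [map_measureReal_apply measurable_snd (measurableSet_singleton b)]
  have : (Prod.snd ⁻¹' {b} : Set (A × B)) = ⋃ a ∈ (Finset.univ : Finset A), {(a, b)} := by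
    ext ⟨a, b'⟩
    simp [eq_comm]
  rw [this, measureReal_biUnion_finset]
  · intro a _ a' _ h
    simp [Function.onFun, h]
  · exact fun a _ => measurableSet_singleton _

lemma sum_measureReal_pair_fst {A B : Type*} [Fintype A] [Fintype B] [MeasurableSpace A]
    [MeasurableSpace B] [MeasurableSingletonClass A] [MeasurableSingletonClass B]
    (κ : Measure (A × B)) [IsFiniteMeasure κ] (a : A) :
    ∑ b, κ.real {(a, b)} = (κ.map Prod.fst).real {a} := by
  classical
  rw [map_measureReal_apply measurable_fst (measurableSet_singleton a)]
  have : (Prod.fst ⁻¹' {a} : Set (A × B)) = ⋃ b ∈ (Finset.univ : Finset B), {(a, b)} := by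
    ext ⟨a', b⟩
    simp [eq_comm]
  rw [this, measureReal_biUnion_finset]
  · intro b _ b' _ h
    simp [Function.onFun, h]
  · exact fun a _ => measurableSet_singleton _

/-- A finite sequence of measures is, up to quantization, the sequence of time marginals of a
finite weighted family of paths whose total length is the sum of the transport costs. -/
lemma exists_paths_of_measures [Nonempty X] (g : ℕ → Measure X) (c : ℝ)
    [hfin : ∀ i, IsFiniteMeasure (g i)] (hc : ∀ i, (g i).real univ = c)
    (hW : ∀ i, W1 (g (i + 1)) (g i) ≠ ⊤) (k : ℕ) {ε : ℝ} (hε : 0 < ε) :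
    ∃ (ι : Type) (_ : Fintype ι) (_ : Nonempty ι) (L : ι → ℝ) (p : ι → ℕ → X) (Q : X → X),
      (∀ j, 0 ≤ L j) ∧ Measurable Q ∧ (∀ z, dist (Q z) z ≤ ε) ∧
      (∀ i ≤ k, ∀ f : X → ℝ, Measurable f → ∑ j, L j * f (p j i) = ∫ z, f (Q z) ∂(g i)) ∧
      ∑ j, L j * ∑ i ∈ Finset.range k, dist (p j (i + 1)) (p j i)
        ≤ ∑ i ∈ Finset.range k, ((W1 (g (i + 1)) (g i)).toReal + ε * (1 + 2 * c)) := by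
  obtain ⟨N, P, r, hP, hr⟩ := exists_measurable_quantization (X := X) hε
  have hr_meas : Measurable r := measurable_of_finite r
  choose π hπfin hπ hπcost using fun i => exists_coupling_integral_dist_le (hW i) hε
  have hPP : Measurable (Prod.map P P) := hP.prodMap hP
  let κ : ℕ → Measure (Fin (N + 1) × Fin (N + 1)) := fun i => (π i).map (Prod.map P P)
  have hκ1 : ∀ i, (κ i).map Prod.fst = (g (i + 1)).map P := by
    intro i
    rw [← (hπ i).1, Measure.map_map measurable_fst hPP, Measure.map_map hP measurable_fst]
    rfl
  have hκ2 : ∀ i, (κ i).map Prod.snd = (g i).map P := by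
    intro i
    rw [← (hπ i).2, Measure.map_map measurable_snd hPP, Measure.map_map hP measurable_snd]
    rfl
  obtain ⟨ι, _, _, L, p, hL, hone, hpair⟩ := exists_paths_of_couplings k
    (fun i a b => (κ i).real {(b, a)}) (fun i a => ((g i).map P).real {a})
    (fun _ _ => measureReal_nonneg) (fun _ _ _ => measureReal_nonneg)
    (fun i _ a => by rw [sum_measureReal_pair_snd, hκ2])
    (fun i _ b => by rw [sum_measureReal_pair_fst, hκ1])
  refine ⟨ι, inferInstance, inferInstance, L, fun j i => r (p j i), fun z => r (P z), hL,
    hr_meas.comp hP, hr, ?_, ?_⟩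
  · intro i hi f hf
    rw [hone i hi (fun a => f (r a)),
      ← integral_map (f := fun a => f (r a)) hP.aemeasurable
        (measurable_of_finite _).aestronglyMeasurable,
      integral_fintype Integrable.of_finite]
    rfl
  · simp_rw [Finset.mul_sum]
    rw [Finset.sum_comm]
    refine Finset.sum_le_sum fun i hi => ?_
    rw [hpair i (Finset.mem_range.1 hi) fun a b => dist (r b) (r a)]
    have h1 : ∑ a, ∑ b, (κ i).real {(b, a)} * dist (r b) (r a)
        = ∫ q, dist (r (P q.1)) (r (P q.2)) ∂(π i) := by
      refine Eq.trans ?_ (integral_map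
        (f := fun q : Fin (N + 1) × Fin (N + 1) => dist (r q.1) (r q.2))
        hPP.aemeasurable (measurable_of_finite _).aestronglyMeasurable)
      rw [integral_fintype Integrable.of_finite, Fintype.sum_prod_type_right]
      rfl
    rw [h1]
    have hd : Integrable (fun q : X × X => dist q.1 q.2) (π i) :=
      integrable_of_continuous (by fun_prop)
    calc _ ≤ ∫ q, (dist q.1 q.2 + 2 * ε) ∂(π i) := by
          refine integral_mono_of_nonneg (ae_of_all _ fun _ => dist_nonneg)
            (hd.add (integrable_const _)) (ae_of_all _ fun q => ?_)
          have h2 := dist_triangle4 (r (P q.1)) q.1 q.2 (r (P q.2))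
          have h3 := hr q.1
          have h4 := hr q.2
          rw [dist_comm] at h4
          simp only
          linarith
      _ = ∫ q, dist q.1 q.2 ∂(π i) + 2 * ε * c := by
          rw [integral_add hd (integrable_const _), integral_const, (hπ i).real_univ, hc,
            smul_eq_mul, mul_comm c]
      _ ≤ _ := by linarith [hπcost i]

lemma varOn_comp_floor_le {X : Type*} [PseudoEMetricSpace X] (p : ℕ → X) (k : ℕ) :
    varOn (fun a b : X => edist a b) (fun t => p ⌊(k : ℝ) * t⌋₊) unitI
      ≤ ∑ i ∈ Finset.range k, edist (p (i + 1)) (p i) := by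
  have h1 : eVariationOn (p ∘ fun t : ℝ => ⌊(k : ℝ) * t⌋₊) unitI
      ≤ eVariationOn p (id '' Iic k) := by
    refine eVariationOn.comp_le_of_monotoneOn p _ ?_ ?_
    · intro s _ t _ hst
      exact Nat.floor_mono (by gcongr)
    · intro t ht
      rw [image_id]
      refine Nat.floor_le_of_le ?_
      exact mul_le_of_le_one_right (Nat.cast_nonneg k) ht.2
  rw [eVariationOn.image_range_of_monotone p monotone_id] at h1
  refine h1.trans_eq (Finset.sum_congr rfl fun i _ => edist_comm _ _)

/-- Discretization in time and space of a curve of measures of bounded variation by a finite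
weighted family of piecewise constant paths. -/
lemma exists_diracCurve_discretization [Nonempty X] {α β : ℝ} (hβ : 0 < β) {g : ℝ → Measure X}
    {c : ℝ} (hfin : ∀ t ∈ unitI, IsFiniteMeasure (g t)) (hc : ∀ t ∈ unitI, (g t).real univ = c)
    (hV : varOn W1M g unitI ≠ ⊤) (k : ℕ) :
    ∃ (ι : Type) (_ : Fintype ι) (_ : Nonempty ι) (L : ι → ℝ) (x : ι → ℝ → X) (Q : X → X),
      (∀ i, 0 ≤ L i) ∧ (∀ i, varOn (fun a b : X => edist a b) (x i) unitI ≠ ⊤) ∧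
      Measurable Q ∧ (∀ z, dist (Q z) z ≤ 1 / ((k : ℝ) + 1)) ∧
      curveCost α β L x
        ≤ α * c + β * ((varOn W1M g unitI).toReal + (1 + 2 * c) * (1 / ((k : ℝ) + 1))) ∧
      ∀ t ∈ unitI, ∀ φ : C(X, ℝ), ∫ z, φ z ∂(diracCurve L x t)
        = ∫ z, φ (Q z) ∂(g (⌊((k + 1 : ℕ) : ℝ) * t⌋₊ / ((k + 1 : ℕ) : ℝ))) := by
  have hk : (0 : ℝ) < ((k + 1 : ℕ) : ℝ) := by positivity
  let u : ℕ → ℝ := fun i => min (i / ((k + 1 : ℕ) : ℝ)) 1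
  have hu : Monotone u := fun i j hij => by
    simp only [u]
    gcongr
  have huI : ∀ i, u i ∈ unitI := fun i => ⟨le_min (by positivity) zero_le_one, min_le_right _ _⟩
  have hstep : ∀ i, W1 (g (u (i + 1))) (g (u i)) ≠ ⊤ := fun i =>
    ne_top_of_le_ne_top hV (dist_le_varOn W1M g (hu (Nat.le_succ i)) (huI i) (huI (i + 1)))
  have : ∀ i, IsFiniteMeasure (g (u i)) := fun i => hfin _ (huI i)
  obtain ⟨ι, _, _, L, p, Q, hL, hQ, hQd, hmarg, hlen⟩ := exists_paths_of_measures
    (fun i => g (u i)) c (fun i => hc _ (huI i)) hstep (k + 1)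
    (ε := 1 / ((k + 1 : ℕ) : ℝ) ^ 2) (by positivity)
  have hvar : ∀ j, varOn (fun a b : X => edist a b)
      (fun t => p j ⌊((k + 1 : ℕ) : ℝ) * t⌋₊) unitI
      ≤ ENNReal.ofReal (∑ i ∈ Finset.range (k + 1), dist (p j (i + 1)) (p j i)) := by
    intro j
    refine (varOn_comp_floor_le (p j) (k + 1)).trans_eq ?_
    rw [ENNReal.ofReal_sum_of_nonneg fun _ _ => dist_nonneg]
    exact Finset.sum_congr rfl fun i _ => edist_dist _ _
  have hmass : ∑ j, L j = c := by
    have h := hmarg 0 (Nat.zero_le _) (fun _ => 1) measurable_const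
    simpa [hc _ (huI 0)] using h
  have hsum : ∑ i ∈ Finset.range (k + 1), (W1 (g (u (i + 1))) (g (u i))).toReal
      ≤ (varOn W1M g unitI).toReal := by
    rw [← ENNReal.toReal_sum fun i _ => hstep i]
    exact ENNReal.toReal_mono hV (sum_le_varOn W1M g (k + 1) hu huI)
  refine ⟨ι, inferInstance, inferInstance, L, fun j t => p j ⌊((k + 1 : ℕ) : ℝ) * t⌋₊, Q, hL,
    fun j => ne_top_of_le_ne_top ENNReal.ofReal_ne_top (hvar j), hQ, fun z => ?_, ?_, ?_⟩
  · refine (hQd z).trans ?_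
    rw [← Nat.cast_add_one]
    refine one_div_le_one_div_of_le hk (le_self_pow₀ ?_ two_ne_zero)
    exact_mod_cast Nat.le_add_left 1 k
  · calc curveCost α β L _
        ≤ ∑ j, (α * L j + β * (L j * ∑ i ∈ Finset.range (k + 1), dist (p j (i + 1)) (p j i))) := by
          refine Finset.sum_le_sum fun j _ => ?_
          have h := ENNReal.toReal_mono ENNReal.ofReal_ne_top (hvar j)
          rw [ENNReal.toReal_ofReal (Finset.sum_nonneg fun _ _ => dist_nonneg)] at h
          have h2 := mul_le_mul_of_nonneg_left h (mul_nonneg hβ.le (hL j))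
          linarith
      _ = α * c + β * ∑ j, L j * ∑ i ∈ Finset.range (k + 1), dist (p j (i + 1)) (p j i) := by
          rw [Finset.sum_add_distrib, ← Finset.mul_sum, ← Finset.mul_sum, hmass]
      _ ≤ _ := by
          gcongr
          refine hlen.trans ?_
          rw [Finset.sum_add_distrib]
          refine add_le_add hsum (le_of_eq ?_)
          rw [Finset.sum_const, Finset.card_range, nsmul_eq_mul]
          push_cast
          field_simp
  · intro t ht φ
    have hfl : ⌊((k + 1 : ℕ) : ℝ) * t⌋₊ ≤ k + 1 :=
      Nat.floor_le_of_le (mul_le_of_le_one_right hk.le ht.2)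
    rw [integral_diracCurve L hL, hmarg _ hfl φ φ.continuous.measurable]
    have : u ⌊((k + 1 : ℕ) : ℝ) * t⌋₊ = ⌊((k + 1 : ℕ) : ℝ) * t⌋₊ / ((k + 1 : ℕ) : ℝ) :=
      min_eq_left ((div_le_one hk).2 (by exact_mod_cast hfl))
    rw [this]

/-- A curve of measures of bounded variation is weakly-* continuous from the left at all
continuity points of its cumulative variation. -/
lemma tendsto_integral_of_continuousAt_cumVar {g : ℝ → Measure X} {c : ℝ}
    (hfin : ∀ t ∈ unitI, IsFiniteMeasure (g t)) (hc : ∀ t ∈ unitI, (g t).real univ = c)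
    (hV : varOn W1M g unitI ≠ ⊤) {t : ℝ} (ht : t ∈ unitI)
    (hcont : ContinuousAt (cumVar W1M g) t) {s : ℕ → ℝ} (hs : Tendsto s atTop (𝓝 t))
    (hst : ∀ k, s k ≤ t) (hsI : ∀ k, s k ∈ unitI) (φ : C(X, ℝ)) :
    Tendsto (fun k => ∫ z, φ z ∂(g (s k))) atTop (𝓝 (∫ z, φ z ∂(g t))) := by
  have hc0 : 0 ≤ c := hc t ht ▸ measureReal_nonneg
  rw [Metric.tendsto_nhds]
  intro ε hε
  obtain ⟨C, hC, hCle⟩ := exists_abs_integral_sub_le φ (η := ε / (2 * (c + 1))) (by positivity)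
  have hlim : Tendsto (fun k => C * (cumVar W1M g t - cumVar W1M g (s k))) atTop (𝓝 0) := by
    have h := ((hcont.tendsto.comp hs).const_sub (cumVar W1M g t)).const_mul C
    simpa using h
  filter_upwards [hlim.eventually_lt_const (half_pos hε)] with k hk
  have hW := dist_le_cumVar_sub (d := W1M) hV (hst k) (hsI k) ht
  have hle := hCle (g t) (g (s k)) (hfin t ht) (ne_top_of_le_ne_top ENNReal.ofReal_ne_top hW)
  have hW' := ENNReal.toReal_mono ENNReal.ofReal_ne_top hW
  rw [ENNReal.toReal_ofReal (sub_nonneg.2 (cumVar_mono hV (hst k)))] at hW'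
  have h1 : ε / (2 * (c + 1)) * c ≤ ε / 2 := by
    rw [div_mul_eq_mul_div, div_le_div_iff₀ (by positivity) two_pos]
    nlinarith
  rw [hc t ht] at hle
  have h2 := mul_le_mul_of_nonneg_left hW' hC
  rw [dist_comm, Real.dist_eq]
  exact hle.trans_lt (by
    change _ + C * (W1M (g t) (g (s k))).toReal < ε
    linarith)

lemma ae_continuousAt_of_monotone {f : ℝ → ℝ} (hf : Monotone f) :
    ∀ᵐ t ∂lebI, ContinuousAt f t :=
  ae_restrict_of_ae (by
    rw [ae_iff]
    exact hf.countable_not_continuousAt.measure_zero volume)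

/-- Curves of measures of bounded variation are limits of finite weighted families of curves with
controlled cost. -/
lemma exists_diracCurve_tendsto [Nonempty X] {α β : ℝ} (hβ : 0 < β) {g : ℝ → Measure X}
    {c : ℝ} (hfin : ∀ t ∈ unitI, IsFiniteMeasure (g t)) (hc : ∀ t ∈ unitI, (g t).real univ = c)
    (hV : varOn W1M g unitI ≠ ⊤) :
    ∃ (ι : ℕ → Type) (_ : ∀ k, Fintype (ι k)) (_ : ∀ k, Nonempty (ι k)) (L : ∀ k, ι k → ℝ)
      (x : ∀ k, ι k → ℝ → X), (∀ k i, 0 ≤ L k i) ∧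
      (∀ k i, varOn (fun a b : X => edist a b) (x k i) unitI ≠ ⊤) ∧
      (∀ k, curveCost α β (L k) (x k)
        ≤ α * c + β * ((varOn W1M g unitI).toReal + (1 + 2 * c) * (1 / ((k : ℝ) + 1)))) ∧
      ∀ᵐ t ∂lebI, WStarTendsto (fun k => diracCurve (L k) (x k) t) (g t) := by
  choose ι hι hne L x Q hL hx hQ hQd hcost hQint using fun k =>
    exists_diracCurve_discretization (α := α) hβ hfin hc hV k
  refine ⟨ι, hι, hne, L, x, hL, hx, hcost, ?_⟩
  filter_upwards [ae_continuousAt_of_monotone (cumVar_mono hV),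
    ae_restrict_mem (s := unitI) measurableSet_Icc] with t hcont ht φ
  let s : ℕ → ℝ := fun k => ⌊((k + 1 : ℕ) : ℝ) * t⌋₊ / ((k + 1 : ℕ) : ℝ)
  have hst : ∀ k, s k ≤ t := fun k => by
    have hk : (0 : ℝ) < ((k + 1 : ℕ) : ℝ) := by positivity
    rw [div_le_iff₀ hk, mul_comm t]
    exact Nat.floor_le (mul_nonneg hk.le ht.1)
  have hsI : ∀ k, s k ∈ unitI := fun k => ⟨by positivity, (hst k).trans ht.2⟩
  have hs : Tendsto s atTop (𝓝 t) := by
    have h := (tendsto_nat_floor_mul_div_atTop ht.1).comp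
      (tendsto_natCast_atTop_atTop.comp (tendsto_add_atTop_nat 1) : Tendsto
        (fun k : ℕ => ((k + 1 : ℕ) : ℝ)) atTop atTop)
    refine h.congr fun k => ?_
    simp [s, mul_comm]
  have hmain := tendsto_integral_of_continuousAt_cumVar hfin hc hV ht hcont hs hst hsI φ
  have hdiff : Tendsto (fun k => ∫ z, φ z ∂(diracCurve (L k) (x k) t) - ∫ z, φ z ∂(g (s k)))
      atTop (𝓝 0) := by
    have hc0 : 0 ≤ c := hc t ht ▸ measureReal_nonneg
    rw [Metric.tendsto_nhds]
    intro ε hε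
    have hη : 0 < ε / (2 * (c + 1)) := by positivity
    obtain ⟨δ, hδ, hφ⟩ := Metric.uniformContinuous_iff.1
      (CompactSpace.uniformContinuous_of_continuous φ.continuous) _ hη
    filter_upwards [tendsto_one_div_add_atTop_nhds_zero_nat.eventually_lt_const hδ] with k hk
    have := hfin _ (hsI k)
    have hbound : ∀ z, ‖φ (Q k z) - φ z‖ ≤ ε / (2 * (c + 1)) := fun z =>
      (hφ ((hQd k z).trans_lt hk)).le
    have hi : Integrable (fun z => φ z) (g (s k)) := integrable_of_continuous φ.continuous
    have hi' : Integrable (fun z => φ (Q k z) - φ z) (g (s k)) :=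
      Integrable.of_bound
        ((φ.continuous.measurable.comp (hQ k)).sub φ.continuous.measurable).aestronglyMeasurable
        _ (ae_of_all _ hbound)
    have heq : ∫ z, φ (Q k z) ∂(g (s k)) - ∫ z, φ z ∂(g (s k))
        = ∫ z, (φ (Q k z) - φ z) ∂(g (s k)) := by
      rw [sub_eq_iff_eq_add, ← integral_add hi' hi]
      simp
    rw [hQint k t ht φ, dist_zero_right]
    change ‖∫ z, φ (Q k z) ∂(g (s k)) - _‖ < ε
    rw [heq]
    refine (norm_integral_le_of_norm_le_const (ae_of_all _ hbound)).trans_lt ?_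
    rw [hc _ (hsI k), div_mul_eq_mul_div, div_lt_iff₀ (by positivity)]
    nlinarith
  simpa using hdiff.add hmain

end Discretization

section Sparsification

variable {n : ℕ} {Ω : Set (EuclideanSpace ℝ (Fin n))}

lemma wt_nonneg (ν : ℝ → Measure ↥Ω) : 0 ≤ wt ν := ENNReal.toReal_nonneg

lemma Reg_nonneg {α β : ℝ} (hα : 0 < α) (hβ : 0 < β) (ν : ℝ → Measure ↥Ω) : 0 ≤ Reg α β ν :=
  add_nonneg (mul_nonneg hα.le (wt_nonneg ν)) (mul_nonneg hβ.le ENNReal.toReal_nonneg)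

lemma exists_varOn_lt_of_essVar_lt {X : Type*} {d : X → X → ℝ≥0∞} {f : ℝ → X} {a : ℝ≥0∞}
    (h : essVar d f < a) : ∃ g : ℝ → X, (∀ᵐ t ∂lebI, g t = f t) ∧ varOn d g unitI < a := by
  simp only [essVar, essVarOn, iInf_lt_iff] at h
  obtain ⟨g, hg, hlt⟩ := h
  exact ⟨g, hg, hlt⟩

lemma essVar_W1M_ne_top {ν : ℝ → Measure ↥Ω} (hν : ν ∈ Adm Ω) : essVar W1M ν ≠ ⊤ := by
  obtain ⟨c, ρ, hρ, hνρ⟩ := hν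
  obtain ⟨σ, hσ, hσfin⟩ := exists_varOn_lt_of_essVar_lt hρ
  have hrep : ∀ᵐ t ∂lebI, (c : ℝ≥0∞) • (σ t : Measure ↥Ω) = ν t :=
    hσ.mono fun t ht => by rw [ht, hνρ t]
  have hle : essVar W1M ν ≤ varOn W1M (fun t => (c : ℝ≥0∞) • (σ t : Measure ↥Ω)) unitI :=
    iInf₂_le_of_le _ hrep le_rfl
  refine ne_top_of_le_ne_top (ENNReal.mul_ne_top (ENNReal.coe_ne_top (r := c)) hσfin.ne)
    (hle.trans (iSup_le ?_))
  rintro ⟨k, u, hu, huS⟩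
  calc _ ≤ ∑ i ∈ Finset.range k, (c : ℝ≥0∞) * W1P (σ (u (i + 1))) (σ (u i)) :=
        Finset.sum_le_sum fun i _ => W1_smul_le c _ _
    _ = c * ∑ i ∈ Finset.range k, W1P (σ (u (i + 1))) (σ (u i)) := (Finset.mul_sum _ _ _).symm
    _ ≤ _ := by
        gcongr
        exact sum_le_varOn W1P σ k hu huS

instance lebI_neZero : NeZero lebI := ⟨by simp [lebI, unitI, Measure.restrict_eq_zero]⟩

/-- An admissible curve has a representative of constant mass with almost optimal variation. -/
lemma exists_representative {ν : ℝ → Measure ↥Ω} (hν : ν ∈ Adm Ω) {ε : ℝ} (hε : 0 < ε) :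
    ∃ g : ℝ → Measure ↥Ω, (∀ᵐ t ∂lebI, g t = ν t) ∧ (∀ t ∈ unitI, IsFiniteMeasure (g t)) ∧
      (∀ t ∈ unitI, (g t).real univ = wt ν) ∧ varOn W1M g unitI ≠ ⊤ ∧
      (varOn W1M g unitI).toReal ≤ (essVar W1M ν).toReal + ε := by
  have hfin := essVar_W1M_ne_top hν
  obtain ⟨g, hg, hlt⟩ := exists_varOn_lt_of_essVar_lt
    (ENNReal.lt_add_right hfin (b := ENNReal.ofReal ε) (by simpa using hε))
  obtain ⟨c, ρ, hρ, hνρ⟩ := hν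
  have hmass : ∀ t, ν t univ = c := fun t => by simp [hνρ]
  have hV : varOn W1M g unitI ≠ ⊤ := hlt.ne_top
  obtain ⟨t₀, hgt, ht₀⟩ := (hg.and (ae_restrict_mem (s := unitI) measurableSet_Icc)).exists
  have hgmass : ∀ t ∈ unitI, g t univ = c := by
    intro t ht
    rw [← hmass t₀, ← hgt]
    rcases le_total t t₀ with h | h
    · exact (measure_univ_eq_of_W1_ne_top
        (ne_top_of_le_ne_top hV (dist_le_varOn W1M g h ht ht₀))).symm
    · exact measure_univ_eq_of_W1_ne_top
        (ne_top_of_le_ne_top hV (dist_le_varOn W1M g h ht₀ ht))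
  refine ⟨g, hg, fun t ht => ⟨by simp [hgmass t ht]⟩, fun t ht => ?_, hV, ?_⟩
  · rw [Measure.real, hgmass t ht, wt, hmass]
  · have h := ENNReal.toReal_mono (by simp [hfin]) hlt.le
    rwa [ENNReal.toReal_add hfin ENNReal.ofReal_ne_top, ENNReal.toReal_ofReal hε.le] at h

lemma WeakTendsto.comp {Y : Type*} [NormedAddCommGroup Y] [InnerProductSpace ℝ Y]
    {ys : ℕ → Y} {y : Y} (h : WeakTendsto ys y) {φ : ℕ → ℕ} (hφ : StrictMono φ) :
    WeakTendsto (fun j => ys (φ j)) y :=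
  fun w => (h w).comp hφ.tendsto_atTop

lemma WeakTendsto.unique {Y : Type*} [NormedAddCommGroup Y] [InnerProductSpace ℝ Y]
    {ys : ℕ → Y} {y z : Y} (hy : WeakTendsto ys y) (hz : WeakTendsto ys z) : y = z :=
  ext_inner_right ℝ fun w => tendsto_nhds_unique (hy w) (hz w)

variable [CompactSpace ↥Ω] [Nonempty ↥Ω] {m : ℕ}
  {K : (ℝ → Measure ↥Ω) → EuclideanSpace ℝ (Fin m)}

/-- Conic Carathéodory reduction of a weighted family of curves to `m` curves with the same data
and no larger cost. -/
lemma exists_diracCurve_fin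
    (hKlin : ∃ Khat : (ℝ → C(↥Ω, ℝ) → ℝ) →ₗ[ℝ] EuclideanSpace ℝ (Fin m),
      ∀ μ ∈ Adm Ω, Khat (toFunc μ) = K μ)
    {α β : ℝ} (hα : 0 < α) (hβ : 0 < β) {ι : Type} [Fintype ι] [Nonempty ι]
    {L : ι → ℝ} {x : ι → ℝ → ↥Ω} (hL : ∀ i, 0 ≤ L i)
    (hx : ∀ i, varOn (fun a b : ↥Ω => edist a b) (x i) unitI ≠ ⊤) :
    ∃ (L' : Fin m → ℝ) (x' : Fin m → ℝ → ↥Ω), (∀ i, 0 ≤ L' i) ∧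
      (∀ i, varOn (fun a b : ↥Ω => edist a b) (x' i) unitI ≠ ⊤) ∧
      K (diracCurve L' x') = K (diracCurve L x) ∧
      curveCost α β L' x' ≤ curveCost α β L x := by
  obtain ⟨Khat, hKhat⟩ := hKlin
  obtain ⟨L', e, hL', hsum, hcost⟩ := exists_conic_combination_fin
    (E := EuclideanSpace ℝ (Fin m)) finrank_euclideanSpace_fin
    (fun i => Khat fun (t : ℝ) (φ : C(↥Ω, ℝ)) => φ (x i t))
    (fun i => α + β * (varOn (fun a b : ↥Ω => edist a b) (x i) unitI).toReal)
    (fun i => by positivity) L hL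
  refine ⟨L', fun i => x (e i), hL', fun i => hx (e i), ?_, hcost⟩
  rw [← hKhat _ (diracCurve_mem_Adm L' hL' _ fun i => hx (e i)),
    ← hKhat _ (diracCurve_mem_Adm L hL x hx), toFunc_diracCurve L' hL', toFunc_diracCurve L hL]
  simpa [map_sum, map_smul] using hsum

/-- Every admissible curve can be replaced by `m` weighted curves with the same data and almost
no larger cost. -/
lemma exists_diracCurve_of_mem_Adm
    (hK : ∀ (μs : ℕ → (ℝ → Measure ↥Ω)) (μ : ℝ → Measure ↥Ω),
      (∀ j, μs j ∈ Adm Ω) → μ ∈ Adm Ω → AEWStar μs μ →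
      WeakTendsto (fun j => K (μs j)) (K μ))
    (hKlin : ∃ Khat : (ℝ → C(↥Ω, ℝ) → ℝ) →ₗ[ℝ] EuclideanSpace ℝ (Fin m),
      ∀ μ ∈ Adm Ω, Khat (toFunc μ) = K μ)
    {α β : ℝ} (hα : 0 < α) (hβ : 0 < β) {ν : ℝ → Measure ↥Ω} (hν : ν ∈ Adm Ω)
    {ε : ℝ} (hε : 0 < ε) :
    ∃ (L : Fin m → ℝ) (x : Fin m → ℝ → ↥Ω), (∀ i, 0 ≤ L i) ∧
      (∀ i, varOn (fun a b : ↥Ω => edist a b) (x i) unitI ≠ ⊤) ∧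
      K (diracCurve L x) = K ν ∧ curveCost α β L x ≤ Reg α β ν + ε := by
  obtain ⟨g, hgν, hgfin, hgmass, hgV, hgle⟩ := exists_representative hν (div_pos hε hβ)
  obtain ⟨ι, _, _, L, x, hL, hx, hcost, hconv⟩ :=
    exists_diracCurve_tendsto (α := α) hβ hgfin hgmass hgV
  choose L' x' hL' hx' hK' hcost' using fun k =>
    exists_diracCurve_fin hKlin hα hβ (hL k) (hx k)
  have hb : Tendsto (fun k : ℕ => α * wt ν + β * ((varOn W1M g unitI).toReal
      + (1 + 2 * wt ν) * (1 / ((k : ℝ) + 1)))) atTop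
      (𝓝 (α * wt ν + β * ((varOn W1M g unitI).toReal + (1 + 2 * wt ν) * 0))) :=
    (((tendsto_one_div_add_atTop_nhds_zero_nat.const_mul _).const_add _).const_mul _).const_add _
  obtain ⟨φ, L₀, x₀, hφ, hL₀, hx₀, hcost₀, hconv₀⟩ := exists_subseq_tendsto_diracCurve hα hβ
    L' x' hL' hx' _ _ hb fun k => (hcost' k).trans (hcost k)
  refine ⟨L₀, x₀, hL₀, hx₀, ?_, hcost₀.trans ?_⟩
  · have h1 := hK (fun j => diracCurve (L' (φ j)) (x' (φ j))) (diracCurve L₀ x₀)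
      (fun j => diracCurve_mem_Adm _ (hL' _) _ (hx' _)) (diracCurve_mem_Adm _ hL₀ _ hx₀)
      ((ae_restrict_mem (s := unitI) measurableSet_Icc).mono hconv₀)
    have h2 := hK (fun k => diracCurve (L k) (x k)) ν
      (fun k => diracCurve_mem_Adm _ (hL k) _ (hx k)) hν
      (by filter_upwards [hconv, hgν] with t ht htν using htν ▸ ht)
    simp only [hK'] at h1
    exact h1.unique (h2.comp hφ)
  · have h := mul_le_mul_of_nonneg_left hgle hβ.le
    rw [mul_add, mul_div_cancel₀ _ hβ.ne'] at h
    rw [Reg]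
    linarith

end Sparsification

section Existence

variable {n : ℕ} {Ω : Set (EuclideanSpace ℝ (Fin n))} [CompactSpace ↥Ω] [Nonempty ↥Ω] {m : ℕ}
  {F : EuclideanSpace ℝ (Fin m) → EReal} {K : (ℝ → Measure ↥Ω) → EuclideanSpace ℝ (Fin m)}

lemma curveCost_nonneg {ι X : Type*} [Fintype ι] [PseudoEMetricSpace X] {α β : ℝ} (hα : 0 < α)
    (hβ : 0 < β) {L : ι → ℝ} (hL : ∀ i, 0 ≤ L i) (x : ι → ℝ → X) : 0 ≤ curveCost α β L x :=
  Finset.sum_nonneg fun i _ => mul_nonneg (hL i) (by positivity)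

/-- A sequence of `m` weighted curves with convergent upper bounds for the costs and for the
fidelities has a limit whose fidelity and cost obey the limiting bounds. -/
lemma exists_diracCurve_le_of_tendsto
    (hFlsc : ∀ (ys : ℕ → EuclideanSpace ℝ (Fin m)) (y : EuclideanSpace ℝ (Fin m)),
      WeakTendsto ys y → F y ≤ Filter.liminf (fun j => F (ys j)) Filter.atTop)
    (hK : ∀ (μs : ℕ → (ℝ → Measure ↥Ω)) (μ : ℝ → Measure ↥Ω),
      (∀ j, μs j ∈ Adm Ω) → μ ∈ Adm Ω → AEWStar μs μ →
      WeakTendsto (fun j => K (μs j)) (K μ))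
    {α β : ℝ} (hα : 0 < α) (hβ : 0 < β) {L : ℕ → Fin m → ℝ} {x : ℕ → Fin m → ℝ → ↥Ω}
    (hL : ∀ j i, 0 ≤ L j i)
    (hx : ∀ j i, varOn (fun a b : ↥Ω => edist a b) (x j i) unitI ≠ ⊤) {a b : ℕ → ℝ} {a₀ b₀ : ℝ}
    (ha : Tendsto a atTop (𝓝 a₀)) (hb : Tendsto b atTop (𝓝 b₀))
    (hF : ∀ j, F (K (diracCurve (L j) (x j))) ≤ a j)
    (hcost : ∀ j, curveCost α β (L j) (x j) ≤ b j) :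
    ∃ (L' : Fin m → ℝ) (x' : Fin m → ℝ → ↥Ω), (∀ i, 0 ≤ L' i) ∧
      (∀ i, varOn (fun a b : ↥Ω => edist a b) (x' i) unitI ≠ ⊤) ∧
      F (K (diracCurve L' x')) ≤ a₀ ∧ curveCost α β L' x' ≤ b₀ := by
  obtain ⟨φ, L', x', hφ, hL', hx', hcost', hconv⟩ :=
    exists_subseq_tendsto_diracCurve hα hβ L x hL hx b b₀ hb hcost
  refine ⟨L', x', hL', hx', ?_, hcost'⟩
  have hw := hK (fun j => diracCurve (L (φ j)) (x (φ j))) (diracCurve L' x')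
    (fun j => diracCurve_mem_Adm _ (hL _) _ (hx _)) (diracCurve_mem_Adm _ hL' _ hx')
    ((ae_restrict_mem (s := unitI) measurableSet_Icc).mono hconv)
  have hlim : Tendsto (fun j => (a (φ j) : EReal)) atTop (𝓝 (a₀ : EReal)) :=
    (continuous_coe_real_ereal.tendsto a₀).comp (ha.comp hφ.tendsto_atTop)
  calc _ ≤ liminf (fun j => F (K (diracCurve (L (φ j)) (x (φ j))))) atTop := hFlsc _ _ hw
    _ ≤ liminf (fun j => (a (φ j) : EReal)) atTop :=
      liminf_le_liminf (Eventually.of_forall fun j => hF (φ j))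
    _ = a₀ := hlim.liminf_eq

/-- The curve tracking problem has a minimizer consisting of `m` weighted curves. -/
lemma exists_diracCurve_minimizer (hFbdd : ∃ B : ℝ, ∀ y, (B : EReal) ≤ F y)
    (hFlsc : ∀ (ys : ℕ → EuclideanSpace ℝ (Fin m)) (y : EuclideanSpace ℝ (Fin m)),
      WeakTendsto ys y → F y ≤ Filter.liminf (fun j => F (ys j)) Filter.atTop)
    (hK : ∀ (μs : ℕ → (ℝ → Measure ↥Ω)) (μ : ℝ → Measure ↥Ω),
      (∀ j, μs j ∈ Adm Ω) → μ ∈ Adm Ω → AEWStar μs μ →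
      WeakTendsto (fun j => K (μs j)) (K μ))
    (hKlin : ∃ Khat : (ℝ → C(↥Ω, ℝ) → ℝ) →ₗ[ℝ] EuclideanSpace ℝ (Fin m),
      ∀ μ ∈ Adm Ω, Khat (toFunc μ) = K μ)
    {α β : ℝ} (hα : 0 < α) (hβ : 0 < β) :
    ∃ (L : Fin m → ℝ) (x : Fin m → ℝ → ↥Ω), (∀ i, 0 ≤ L i) ∧
      (∀ i, varOn (fun a b : ↥Ω => edist a b) (x i) unitI ≠ ⊤) ∧
      ∀ ν ∈ Adm Ω, F (K (diracCurve L x)) + (Reg α β (diracCurve L x) : EReal)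
        ≤ F (K ν) + (Reg α β ν : EReal) := by
  obtain ⟨B, hB⟩ := hFbdd
  let T : Set ℝ := {r | ∃ ν ∈ Adm Ω, ∃ f : ℝ, F (K ν) = f ∧ f + Reg α β ν ≤ r}
  have hT : ∀ ν ∈ Adm Ω, ∀ r : ℝ, F (K ν) + (Reg α β ν : EReal) < r → r ∈ T := by
    intro ν hν r hr
    have hbot : F (K ν) ≠ ⊥ := ((EReal.bot_lt_coe B).trans_le (hB _)).ne'
    have htop : F (K ν) ≠ ⊤ := by
      intro h
      rw [h, EReal.top_add_coe] at hr
      exact not_top_lt hr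
    lift F (K ν) to ℝ using ⟨htop, hbot⟩ with f hf
    exact ⟨ν, hν, f, hf.symm, by exact_mod_cast hr.le⟩
  rcases T.eq_empty_or_nonempty with hempty | hne
  · refine ⟨0, fun _ _ => Classical.arbitrary ↥Ω, fun _ => le_rfl, fun _ => by simp [varOn_const],
      fun ν hν => ?_⟩
    refine EReal.le_of_forall_lt_iff_le.1 fun r hr => ?_
    exact absurd (hT ν hν r hr) (by simp [hempty])
  have hbdd : BddBelow T := by
    refine ⟨B, ?_⟩
    rintro r ⟨ν, -, f, hf, hr⟩
    have h1 : B ≤ f := by exact_mod_cast hf ▸ hB (K ν)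
    linarith [Reg_nonneg hα hβ ν]
  have hseq : ∀ j : ℕ, ∃ (L : Fin m → ℝ) (x : Fin m → ℝ → ↥Ω) (f : ℝ), (∀ i, 0 ≤ L i) ∧
      (∀ i, varOn (fun a b : ↥Ω => edist a b) (x i) unitI ≠ ⊤) ∧
      F (K (diracCurve L x)) = f ∧
      f + curveCost α β L x ≤ sInf T + 2 * (1 / ((j : ℝ) + 1)) := by
    intro j
    have hj : (0 : ℝ) < 1 / ((j : ℝ) + 1) := by positivity
    obtain ⟨r, ⟨ν, hν, f, hf, hr⟩, hlt⟩ := exists_lt_of_csInf_lt hne (lt_add_of_pos_right _ hj)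
    obtain ⟨L, x, hL, hx, hKeq, hcost⟩ := exists_diracCurve_of_mem_Adm hK hKlin hα hβ hν hj
    exact ⟨L, x, f, hL, hx, by rw [hKeq, hf], by linarith⟩
  choose L x f hL hx hf hle using hseq
  have hfB : ∀ j, B ≤ f j := fun j => by exact_mod_cast hf j ▸ hB _
  have hcost : ∀ j, curveCost α β (L j) (x j) ∈ Icc 0 (sInf T + 2 - B) := fun j => by
    refine ⟨curveCost_nonneg hα hβ (hL j) (x j), ?_⟩
    have hj : 1 / ((j : ℝ) + 1) ≤ 1 := by
      rw [div_le_one (by positivity)]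
      linarith [(Nat.cast_nonneg j : (0 : ℝ) ≤ j)]
    linarith [hfB j, hle j]
  obtain ⟨c, -, φ, hφ, hc⟩ := isCompact_Icc.tendsto_subseq hcost
  have ha : Tendsto (fun j => sInf T + 2 * (1 / ((φ j : ℝ) + 1))
      - curveCost α β (L (φ j)) (x (φ j))) atTop (𝓝 (sInf T + 2 * 0 - c)) :=
    (((tendsto_one_div_add_atTop_nhds_zero_nat.comp hφ.tendsto_atTop).const_mul _).const_add
      _).sub hc
  obtain ⟨L', x', hL', hx', hF', hcost'⟩ := exists_diracCurve_le_of_tendsto (F := F) (K := K)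
    hFlsc hK hα hβ (fun j => hL (φ j)) (fun j => hx (φ j)) ha hc
    (fun j => by
      rw [hf]
      exact_mod_cast le_sub_iff_add_le.2 (hle (φ j)))
    fun j => le_rfl
  refine ⟨L', x', hL', hx', fun ν hν => ?_⟩
  refine le_trans ?_ (EReal.le_of_forall_lt_iff_le.1 fun r hr =>
    EReal.coe_le_coe_iff.2 (csInf_le hbdd (hT ν hν r hr)))
  calc _ ≤ ((sInf T + 2 * 0 - c : ℝ) : EReal) + (c : EReal) :=
        add_le_add hF' (EReal.coe_le_coe_iff.2 ((Reg_diracCurve_le hβ L' hL' x' hx').trans hcost'))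
    _ = ((sInf T : ℝ) : EReal) := by
        rw [← EReal.coe_add]
        simp

end Existence

/-- Existence of a sparse solution / representer theorem: if the fidelity
`𝓕` is convex and the forward operator `K` is linear with values in `Y = ℝᵐ` and admits a
linear extension beyond `𝒜`, then the BV curve tracking problem has a solution which is a.e.
a sum of at most `m` weighted Diracs travelling along BV curves in `Ω`. -/
theorem representer_sparse_solution
    {n : ℕ} (Ω : Set (EuclideanSpace ℝ (Fin n)))
    (hΩne : Ω.Nonempty) (hΩcp : IsCompact Ω) (hΩcv : Convex ℝ Ω)
    (m : ℕ) (F : EuclideanSpace ℝ (Fin m) → EReal)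
    (hFbdd : ∃ B : ℝ, ∀ y, (B : EReal) ≤ F y)
    (hFproper : ∃ y, F y ≠ ⊤)
    (hFlsc : ∀ (ys : ℕ → EuclideanSpace ℝ (Fin m)) (y : EuclideanSpace ℝ (Fin m)),
      WeakTendsto ys y → F y ≤ Filter.liminf (fun j => F (ys j)) Filter.atTop)
    (hFconv : ∀ (y z : EuclideanSpace ℝ (Fin m)) (a b : ℝ), 0 ≤ a → 0 ≤ b → a + b = 1 →
      F (a • y + b • z) ≤ (a : EReal) * F y + (b : EReal) * F z)
    (K : (ℝ → Measure ↥Ω) → EuclideanSpace ℝ (Fin m))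
    (hK : ∀ (μs : ℕ → (ℝ → Measure ↥Ω)) (μ : ℝ → Measure ↥Ω),
      (∀ j, μs j ∈ Adm Ω) → μ ∈ Adm Ω → AEWStar μs μ →
      WeakTendsto (fun j => K (μs j)) (K μ))
    (hKlin : ∃ Khat : (ℝ → C(↥Ω, ℝ) → ℝ) →ₗ[ℝ] EuclideanSpace ℝ (Fin m),
      ∀ μ ∈ Adm Ω, Khat (toFunc μ) = K μ)
    (α β : ℝ) (hα : 0 < α) (hβ : 0 < β) :
    ∃ μopt ∈ Adm Ω,
      (∀ ν ∈ Adm Ω,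
        F (K μopt) + (Reg α β μopt : EReal) ≤ F (K ν) + (Reg α β ν : EReal)) ∧
      ∃ N : ℕ, N ≤ m ∧ ∃ (lam : Fin N → ℝ) (x : Fin N → ℝ → ↥Ω),
        (∀ i, 0 ≤ lam i) ∧
        (∀ i, essVar (fun a b : ↥Ω => edist a b) (x i) < ⊤) ∧
        ∀ᵐ t ∂lebI, μopt t = ∑ i, ENNReal.ofReal (lam i) • Measure.dirac (x i t) := by
  have : CompactSpace ↥Ω := isCompact_iff_compactSpace.1 hΩcp
  have : Nonempty ↥Ω := hΩne.to_subtype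
  obtain ⟨L, x, hL, hx, hmin⟩ := exists_diracCurve_minimizer hFbdd hFlsc hK hKlin hα hβ
  exact ⟨diracCurve L x, diracCurve_mem_Adm L hL x hx, hmin, m, le_rfl, L, x, hL,
    fun i => (essVar_le_varOn _ _).trans_lt (lt_top_iff_ne_top.2 (hx i)), ae_of_all _ fun _ => rfl⟩

end
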